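/- arXiv:math/0611668 — 2 statements merged into one kernel-verified Lean document; each statement's English description precedes it below -/
import Mathlib

section
/- Let G₁ and G₂ be nontrivial finitely generated groups with finite generating sets S₁ and S₂, and consider Bernoulli bond percolation on the Cayley graph of G₁*G₂ with respect to S₁ ⊔ S₂. Let P₁ be the set of nontrivial elements of G₁*G₂ whose normal form begins with a nontrivial syllable of G₁, and P₂ similarly for G₂; let A(p) (resp. B(p)) be the P_p-probability that the cluster of the identity e in the subgraph using only open edges with both endpoints in {e} ∪ P₁ (resp. {e} ∪ P₂) is infinite. Then for every p ∈ [0,1]: A(p) = g₁(p, B(p)) and B(p) = g₂(p, A(p)), where gᵢ is the walk-through function of (Gᵢ,Sᵢ). -/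
open MeasureTheory ENNReal

namespace Perc

/-- Percolation configurations on the edge set `E`: each edge is `true` (open) or
`false` (closed). -/
abbrev Config (E : Type*) := E → Bool

/-- `μ` is the Bernoulli product measure `P_p` with parameter `p` on `{0,1}^E`: the measure
of every finite cylinder event is the corresponding product.  (This determines `μ` uniquely
on the product σ-algebra, since cylinders form a π-system generating it.) -/
def IsBernoulli {E : Type*} (p : ℝ) (μ : Measure (Config E)) : Prop :=
  ∀ (F : Finset E) (σ : E → Bool),
    μ {ω | ∀ e ∈ F, ω e = σ e} =
      ∏ e ∈ F, ENNReal.ofReal (if σ e then p else 1 - p)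

variable {G ι : Type*} [Group G]

/-- In the Cayley graph of `G` with edge set `G × ι`, where the edge `(a, i)` joins `a` and
`a * f i` (the function `f : ι → G` lists the generators, with multiplicity), this says that
vertices `a` and `b` are joined by some open edge of the configuration `ω`. -/
def Step (f : ι → G) (ω : Config (G × ι)) (a b : G) : Prop :=
  ∃ i : ι, (ω (a, i) = true ∧ b = a * f i) ∨ (ω (b, i) = true ∧ a = b * f i)

/-- `x` and `y` are connected by a path of open edges (`x ↔ y`). -/
def Conn (f : ι → G) (ω : Config (G × ι)) (x y : G) : Prop :=
  Relation.ReflTransGen (Step f ω) x y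

/-- The open cluster `C` of the identity. -/
def cluster (f : ι → G) (ω : Config (G × ι)) : Set G :=
  {x | Conn f ω 1 x}

/-- The percolation function `θ`: the probability that the cluster of the identity is
infinite. -/
noncomputable def theta (f : ι → G) (μ : Measure (Config (G × ι))) : ℝ :=
  (μ {ω | (cluster f ω).Infinite}).toReal

/-- The expected cluster size `χ = E(|C|) ∈ [0,∞]` (where `|C| ∈ ℕ∞` is coerced
to `ℝ≥0∞`). -/
noncomputable def chi (f : ι → G) (μ : Measure (Config (G × ι))) : ℝ≥0∞ :=
  ∫⁻ ω, ((cluster f ω).encard : ℝ≥0∞) ∂μ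

/-- The critical probability `p_c = inf {p ∈ [0,1] | θ(p) > 0}`, with the convention
`p_c = 1` if `θ` vanishes on `[0,1]`; here `μ p` is the percolation measure at
parameter `p`. -/
noncomputable def pc (f : ι → G) (μ : ℝ → Measure (Config (G × ι))) : ℝ :=
  sInf ({p | p ∈ Set.Icc (0 : ℝ) 1 ∧ 0 < theta f (μ p)} ∪ {1})

/-- The word metric on `G` with respect to the generators `f i`: the length of a shortest
word in the generators and their inverses taking `x` to `y`.  (When the generators generate
`G`, this is the graph distance in the Cayley graph.) -/
noncomputable def wdist (f : ι → G) (x y : G) : ℕ :=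
  sInf {n : ℕ | ∃ l : List G, l.length = n ∧
    (∀ g ∈ l, (∃ i, f i = g) ∨ (∃ i, (f i)⁻¹ = g)) ∧ x * l.prod = y}

/-- Schonmann's critical point
`p_exp = sup {p ∈ [0,1] | ∃ c > 0, γ > 0, ∀ x y, P_p(x ↔ y) ≤ c·exp(-γ·dist(x,y))}`. -/
noncomputable def pexp (f : ι → G) (μ : ℝ → Measure (Config (G × ι))) : ℝ :=
  sSup {p | p ∈ Set.Icc (0 : ℝ) 1 ∧ ∃ c > 0, ∃ γ > 0, ∀ x y : G,
    (μ p {ω | Conn f ω x y}).toReal ≤ c * Real.exp (-γ * (wdist f x y : ℝ))}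

/-- The walk-through function `g(p,t) = 1 - ∑_{n≥1} (1-t)^{n-1} P_p(|C| = n)` of a Cayley
graph; here `μ` is the percolation measure at parameter `p`. -/
noncomputable def wt (f : ι → G) (μ : Measure (Config (G × ι))) (t : ℝ) : ℝ :=
  1 - ∑' n : ℕ, (1 - t) ^ n * (μ {ω | (cluster f ω).encard = ((n + 1 : ℕ) : ℕ∞)}).toReal

/-- The ball of radius `j`: all products of at most `j` elements of `S ∪ S⁻¹`. -/
def ball (S : Set G) (j : ℕ) : Set G :=
  {g | ∃ l : List G, l.length ≤ j ∧ (∀ x ∈ l, x ∈ S ∨ x⁻¹ ∈ S) ∧ l.prod = g}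

/-- The Cheeger constant `h = inf_K |∂K| / |K|`, the infimum over nonempty finite vertex
sets `K` of the number of edges `(a, i)` (joining `a` and `a * f i`) with exactly one
endpoint in `K`, divided by `|K|`. -/
noncomputable def cheeger (f : ι → G) : ℝ :=
  ⨅ K : {K : Finset G // K.Nonempty},
    (Nat.card {e : G × ι // Xor' (e.1 ∈ K.1) (e.1 * f e.2 ∈ K.1)} : ℝ) / (K.1.card : ℝ)

/-- The open cluster of the identity in the subgraph induced on the vertex set `V`: only
open edges with both endpoints in `V` may be used. -/
def clusterIn (f : ι → G) (V : Set G) (ω : Config (G × ι)) : Set G :=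
  {x | Relation.ReflTransGen (fun a b => Step f ω a b ∧ a ∈ V ∧ b ∈ V) 1 x}

/-- The generators of `G` given by a generating set `S` (one edge orbit per element
of `S`). -/
def setGens (S : Set G) : S → G := Subtype.val

/-- The generators of the free product `G₁ * G₂` given by the disjoint union `S₁ ⊔ S₂` of
generating sets, embedded via the canonical monomorphisms. -/
def coprodGens {G₁ G₂ : Type*} [Group G₁] [Group G₂] (S₁ : Set G₁) (S₂ : Set G₂) :
    S₁ ⊕ S₂ → Monoid.Coprod G₁ G₂ :=
  Sum.elim (fun s => Monoid.Coprod.inl (s : G₁)) (fun s => Monoid.Coprod.inr (s : G₂))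

/-- The generators of the free product `G₁ * ⋯ * G_n` given by the disjoint union
`S₁ ⊔ ⋯ ⊔ S_n` of generating sets, embedded via the canonical monomorphisms. -/
def coprodIGens {n : ℕ} {G : Fin n → Type*} [∀ i, Group (G i)] (S : ∀ i, Set (G i)) :
    (Σ i, S i) → Monoid.CoprodI G :=
  fun x => Monoid.CoprodI.of (x.2 : G x.1)

/-- The image of a list of syllables in the free product `G₁ * G₂`. -/
def sylProd {G₁ G₂ : Type*} [Group G₁] [Group G₂] (l : List (G₁ ⊕ G₂)) :
    Monoid.Coprod G₁ G₂ :=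
  (l.map (Sum.elim (fun g => Monoid.Coprod.inl g) (fun h => Monoid.Coprod.inr h))).prod

/-- The set `P₁` of nontrivial elements of `G₁ * G₂` whose normal form begins with a
nontrivial syllable of `G₁`: elements represented by a nonempty alternating product of
nontrivial syllables, the first syllable lying in `G₁`.  (Such a representation is the
normal form, which is unique.) -/
def beginsLeft {G₁ G₂ : Type*} [Group G₁] [Group G₂] (x : Monoid.Coprod G₁ G₂) : Prop :=
  ∃ l : List (G₁ ⊕ G₂), l ≠ [] ∧ (∀ a ∈ l, a ≠ Sum.inl 1 ∧ a ≠ Sum.inr 1) ∧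
    l.Chain' (fun a b => a.isLeft ≠ b.isLeft) ∧
    (∃ g : G₁, l.head? = some (Sum.inl g)) ∧ sylProd l = x

/-- The set `P₂` of nontrivial elements of `G₁ * G₂` whose normal form begins with a
nontrivial syllable of `G₂`. -/
def beginsRight {G₁ G₂ : Type*} [Group G₁] [Group G₂] (x : Monoid.Coprod G₁ G₂) : Prop :=
  ∃ l : List (G₁ ⊕ G₂), l ≠ [] ∧ (∀ a ∈ l, a ≠ Sum.inl 1 ∧ a ≠ Sum.inr 1) ∧
    l.Chain' (fun a b => a.isLeft ≠ b.isLeft) ∧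
    (∃ h : G₂, l.head? = some (Sum.inr h)) ∧ sylProd l = x

end Perc

open Perc

namespace Perc

open ProbabilityTheory

section EdgeLaw

/-- The law of the state of a single edge. -/
noncomputable def edgeLaw (p : ℝ) : Measure Bool :=
  ENNReal.ofReal p • Measure.dirac true + ENNReal.ofReal (1 - p) • Measure.dirac false

lemma isProbabilityMeasure_edgeLaw {p : ℝ} (hp : p ∈ Set.Icc (0 : ℝ) 1) :
    IsProbabilityMeasure (edgeLaw p) := by
  refine ⟨?_⟩
  simp only [edgeLaw, Measure.coe_add, Measure.coe_smul, Pi.add_apply, Pi.smul_apply,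
    measure_univ, smul_eq_mul, mul_one]
  rw [← ENNReal.ofReal_add hp.1 (by linarith [hp.2])]
  simp

lemma edgeLaw_singleton (p : ℝ) (b : Bool) :
    edgeLaw p {b} = ENNReal.ofReal (if b then p else 1 - p) := by
  cases b <;> simp [edgeLaw]

lemma set_bool_cases (A : Set Bool) : A = ∅ ∨ A = Set.univ ∨ ∃ b, A = {b} := by
  by_cases ht : true ∈ A <;> by_cases hf : false ∈ A
  · exact Or.inr (Or.inl (by ext b; cases b <;> simp [ht, hf]))
  · exact Or.inr (Or.inr ⟨true, by ext b; cases b <;> simp [ht, hf]⟩)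
  · exact Or.inr (Or.inr ⟨false, by ext b; cases b <;> simp [ht, hf]⟩)
  · exact Or.inl (by ext b; cases b <;> simp [ht, hf])

lemma IsBernoulli.eq_infinitePi {E : Type*} {p : ℝ} [IsProbabilityMeasure (edgeLaw p)]
    {μ : Measure (Config E)} (h : IsBernoulli p μ) :
    μ = Measure.infinitePi (fun _ : E => edgeLaw p) := by
  classical
  refine Measure.eq_infinitePi _ fun s t _ => ?_
  by_cases hs : ∃ i ∈ s, t i = ∅
  · obtain ⟨i, hi, hti⟩ := hs
    rw [Finset.prod_eq_zero hi (by simp [hti]), Set.pi_eq_empty (i := i) (by simpa using hi) hti,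
      measure_empty]
  · push Not at hs
    have key : ∀ i, ∃ b : Bool, i ∈ s → t i ≠ Set.univ → t i = {b} := by
      intro i
      rcases set_bool_cases (t i) with h0 | h1 | ⟨b, hb⟩
      · exact ⟨true, fun hi => absurd h0 (hs i hi).ne_empty⟩
      · exact ⟨true, fun _ h => absurd h1 h⟩
      · exact ⟨b, fun _ _ => hb⟩
    choose σ hσ using key
    have hset : Set.pi (s : Set E) t =
        {ω : Config E | ∀ e ∈ s.filter (fun i => t i ≠ Set.univ), ω e = σ e} := by
      ext ω
      simp only [Set.mem_pi, Finset.mem_coe, Finset.mem_filter, Set.mem_ofPred_eq, and_imp]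
      refine forall_congr' fun i => forall_congr' fun hi => ?_
      by_cases hu : t i = Set.univ
      · simp [hu]
      · simp only [hσ i hi hu, Set.mem_singleton_iff, ne_eq, hσ i hi hu ▸ hu, not_false_eq_true,
          true_imp_iff]
    rw [hset, h, Finset.prod_filter]
    refine Finset.prod_congr rfl fun i hi => ?_
    by_cases hu : t i = Set.univ
    · rw [if_neg (not_not.2 hu), hu, measure_univ]
    · rw [if_pos hu, hσ i hi hu, edgeLaw_singleton]

end EdgeLaw

section Independence

variable {E κ : Type*} {ν : Measure Bool} [IsProbabilityMeasure ν]

/-- An event determined by the edges in `T` belongs to the σ-algebra generated by those edges. -/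
lemma measurableSet_iSup_comap_eval {T : Set E} {D : Set (Config E)} (hD : MeasurableSet D)
    (hdep : ∀ ω ω' : Config E, (∀ e ∈ T, ω e = ω' e) → ω ∈ D → ω' ∈ D) :
    MeasurableSet[⨆ e ∈ T, MeasurableSpace.comap (fun ω : Config E => ω e) ⊤] D := by
  classical
  let r : Config E → Config E := fun ω e => if e ∈ T then ω e else false
  have hr : Measurable[⨆ e ∈ T, MeasurableSpace.comap (fun ω : Config E => ω e) ⊤] r := by
    refine (@measurable_pi_iff _ _ _ (_) _ _).2 fun e => ?_
    by_cases he : e ∈ T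
    · simp only [r, if_pos he]
      exact measurable_iff_comap_le.2
        (le_iSup₂_of_le (f := fun e (_ : e ∈ T) =>
          MeasurableSpace.comap (fun ω : Config E => ω e) ⊤) e he le_rfl)
    · simp only [r, if_neg he]
      exact @measurable_const _ _ _ (_) _
  have : D = r ⁻¹' D := by
    ext ω
    exact ⟨hdep _ _ fun e he => by simp [r, he], hdep _ _ fun e he => by simp [r, he]⟩
  rw [this]
  exact hr hD

/-- Events determined by pairwise disjoint sets of edges are independent. -/
lemma infinitePi_biInter_of_disjoint {T : κ → Set E} (hT : Pairwise (Function.onFun Disjoint T))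
    {D : κ → Set (Config E)} (hD : ∀ k, MeasurableSet (D k))
    (hdep : ∀ k, ∀ ω ω' : Config E, (∀ e ∈ T k, ω e = ω' e) → ω ∈ D k → ω' ∈ D k)
    (F : Finset κ) :
    Measure.infinitePi (fun _ : E => ν) (⋂ k ∈ F, D k) =
      ∏ k ∈ F, Measure.infinitePi (fun _ : E => ν) (D k) := by
  classical
  have hind : iIndep (fun e : E => MeasurableSpace.comap (fun ω : Config E => ω e) ⊤)
      (Measure.infinitePi (fun _ : E => ν)) :=
    (iIndepFun_iff_iIndep _ _ _).1
      (iIndepFun_infinitePi (P := fun _ : E => ν) (X := fun _ b => b) (fun _ => measurable_id))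
  have hle : ∀ e : E, MeasurableSpace.comap (fun ω : Config E => ω e) ⊤ ≤ MeasurableSpace.pi :=
    fun e => measurable_iff_comap_le.1 (measurable_pi_apply e)
  induction F using Finset.induction_on with
  | empty => simp
  | insert a F ha ih =>
    rw [Finset.prod_insert ha, Finset.set_biInter_insert, ← ih]
    have hdisj : Disjoint (T a) (⋃ k ∈ F, T k) := by
      rw [Set.disjoint_iUnion₂_right]
      exact fun k hk => hT (by rintro rfl; exact ha hk)
    refine (Indep_iff _ _ _).1 (indep_iSup_of_disjoint hle hind hdisj) _ _
      (measurableSet_iSup_comap_eval (hD a) (hdep a))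
      (measurableSet_iSup_comap_eval (Finset.measurableSet_biInter _ fun k _ => hD k) ?_)
    intro ω ω' h hω
    simp only [Set.mem_iInter] at hω ⊢
    exact fun k hk => hdep k ω ω' (fun e he => h e (Set.mem_biUnion hk he)) (hω k hk)

lemma measurePreserving_reindex {α : Type*} {u : α → E} (hu : Function.Injective u) :
    MeasurePreserving (fun (ω : Config E) a => ω (u a))
      (Measure.infinitePi (fun _ : E => ν)) (Measure.infinitePi (fun _ : α => ν)) :=
  ⟨measurable_pi_iff.2 fun a => measurable_pi_apply (u a),
    Measure.map_infinitePi_infinitePi_of_inj (P := fun _ : E => ν) hu⟩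

end Independence

section Measurability

variable {Ω α : Type*} [MeasurableSpace Ω] [Countable α]

lemma measurableSet_reflTransGen {r : Ω → α → α → Prop}
    (hr : ∀ a b, MeasurableSet {ω | r ω a b}) (a b : α) :
    MeasurableSet {ω | Relation.ReflTransGen (r ω) a b} := by
  let S : ℕ → α → Set Ω := fun n =>
    Nat.rec (fun b => {_ω | a = b}) (fun _ A b => ⋃ c, A c ∩ {ω | r ω c b}) n
  have hS : ∀ n b, MeasurableSet (S n b) := by
    intro n
    induction n with
    | zero => exact fun b => MeasurableSet.const _
    | succ n ih => exact fun b => MeasurableSet.iUnion fun c => (ih c).inter (hr c b)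
  have : {ω | Relation.ReflTransGen (r ω) a b} = ⋃ n, S n b := by
    ext ω
    simp only [Set.mem_ofPred_eq, Set.mem_iUnion]
    constructor
    · intro h
      induction h with
      | refl => exact ⟨0, rfl⟩
      | tail _ h ih =>
        obtain ⟨n, hn⟩ := ih
        exact ⟨n + 1, Set.mem_iUnion.2 ⟨_, hn, h⟩⟩
    · rintro ⟨n, hn⟩
      induction n generalizing b with
      | zero => obtain rfl : a = b := hn; exact .refl
      | succ n ih =>
        obtain ⟨c, hc, hcb⟩ := Set.mem_iUnion.1 hn
        exact (ih c hc).tail hcb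
  rw [this]
  exact MeasurableSet.iUnion fun n => hS n b

lemma measurableSet_eq_of_mem {C : Ω → Set α} (hC : ∀ x, MeasurableSet {ω | x ∈ C ω})
    (s : Set α) : MeasurableSet {ω | C ω = s} := by
  have : {ω | C ω = s} = ⋂ x, {ω | x ∈ C ω ↔ x ∈ s} := by
    ext ω
    simp [Set.ext_iff]
  rw [this]
  exact MeasurableSet.iInter fun x => (hC x).iff (MeasurableSet.const _)

lemma measurableSet_finite_of_mem {C : Ω → Set α} (hC : ∀ x, MeasurableSet {ω | x ∈ C ω}) :
    MeasurableSet {ω | (C ω).Finite} := by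
  have : {ω | (C ω).Finite} = ⋃ K : Finset α, {ω | C ω = K} := by
    ext ω
    simp only [Set.mem_ofPred_eq, Set.mem_iUnion]
    exact ⟨fun h => ⟨h.toFinset, by simp⟩, fun ⟨K, hK⟩ => hK ▸ K.finite_toSet⟩
  rw [this]
  exact MeasurableSet.iUnion fun K => measurableSet_eq_of_mem hC _

end Measurability

section Clusters

variable {Γ ι : Type*} [Group Γ] [Countable ι]

lemma measurableSet_step (f : ι → Γ) (a b : Γ) :
    MeasurableSet {ω : Config (Γ × ι) | Step f ω a b} := by
  have hopen : ∀ e : Γ × ι, MeasurableSet {ω : Config (Γ × ι) | ω e = true} := fun e =>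
    (measurable_pi_apply e : Measurable fun ω : Config (Γ × ι) => ω e)
      (measurableSet_singleton true)
  have : {ω : Config (Γ × ι) | Step f ω a b} =
      ⋃ i, ({ω | ω (a, i) = true} ∩ {_ω | b = a * f i}) ∪
        ({ω | ω (b, i) = true} ∩ {_ω | a = b * f i}) := by
    ext ω
    simp [Step]
  rw [this]
  exact MeasurableSet.iUnion fun i => ((hopen _).inter (MeasurableSet.const _)).union
    ((hopen _).inter (MeasurableSet.const _))

lemma measurableSet_mem_cluster [Countable Γ] (f : ι → Γ) (x : Γ) :
    MeasurableSet {ω : Config (Γ × ι) | x ∈ cluster f ω} :=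
  measurableSet_reflTransGen (measurableSet_step f) 1 x

lemma measurableSet_mem_clusterIn [Countable Γ] (f : ι → Γ) (V : Set Γ) (x : Γ) :
    MeasurableSet {ω : Config (Γ × ι) | x ∈ clusterIn f V ω} :=
  measurableSet_reflTransGen (fun a b => (measurableSet_step f a b).inter (MeasurableSet.const _))
    1 x

end Clusters

section TreeDecomposition

variable {Γ H ι κ : Type*} [Group Γ] [Group H] {f : ι → Γ} {f' : κ → H} {φ : H →* Γ} {j : κ → ι}
  {V W : Set Γ}

/-- The subgraph of the Cayley graph of `(Γ, f)` induced on `V` is obtained from the Cayley graph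
of `(H, f')`, embedded via `φ` and `j`, by attaching to each vertex `φ g` with `g ≠ 1` the
translate `φ g * W`. -/
structure TreeDecomposition (f : ι → Γ) (f' : κ → H) (φ : H →* Γ) (j : κ → ι) (V W : Set Γ) :
    Prop where
  gens_apply : ∀ k, f (j k) = φ (f' k)
  gens_injective : Function.Injective j
  one_mem : (1 : Γ) ∈ W
  mem_iff : ∀ x, x ∈ V ↔ x = 1 ∨ ∃ g, g ≠ 1 ∧ ∃ y ∈ W, x = φ g * y
  eq_of_mul_eq : ∀ {g g' y y'}, y ∈ W → y' ∈ W → φ g * y = φ g' * y' → g = g'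
  mul_mem : ∀ {y} i, y ∈ W → (y = 1 ∧ i ∈ Set.range j) ∨ y * f i ∈ W

/-- The configuration on the Cayley graph of a factor. -/
def restrict (φ : H →* Γ) (j : κ → ι) (ω : Config (Γ × ι)) : Config (H × κ) :=
  fun e => ω (φ e.1, j e.2)

/-- The configuration seen from the vertex `x`. -/
def translate (x : Γ) (ω : Config (Γ × ι)) : Config (Γ × ι) :=
  fun e => ω (x * e.1, e.2)

lemma step_translate {x : Γ} {ω : Config (Γ × ι)} {a b : Γ} :
    Step f (translate x ω) a b ↔ Step f ω (x * a) (x * b) := by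
  simp [Step, translate, mul_assoc]

namespace TreeDecomposition

variable (h : TreeDecomposition f f' φ j V W)
include h

lemma injective : Function.Injective φ := fun g g' hg =>
  h.eq_of_mul_eq h.one_mem h.one_mem (by simpa using hg)

lemma one_mem_left : (1 : Γ) ∈ V := (h.mem_iff 1).2 (.inl rfl)

lemma mul_mem_left {g : H} {y : Γ} (hg : g ≠ 1) (hy : y ∈ W) : φ g * y ∈ V :=
  (h.mem_iff _).2 (.inr ⟨g, hg, y, hy, rfl⟩)

lemma map_mem_left (g : H) : φ g ∈ V := by
  by_cases hg : g = 1
  · simpa [hg] using h.one_mem_left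
  · simpa using h.mul_mem_left hg h.one_mem

lemma eq_one_of_map_mem {g : H} (hg : φ g ∈ W) : g = 1 :=
  (h.eq_of_mul_eq hg h.one_mem (g := 1) (g' := g) (by simp)).symm

lemma eq_one_of_mem {x : Γ} (hV : x ∈ V) (hW : x ∈ W) : x = 1 := by
  rcases (h.mem_iff x).1 hV with rfl | ⟨g, hg, y, hy, hxy⟩
  · rfl
  · exact absurd (h.eq_of_mul_eq hW hy (g := 1) (by simpa using hxy)).symm hg

lemma restrict_step {ω : Config (Γ × ι)} {g g' : H} (hs : Step f' (restrict φ j ω) g g') :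
    Step f ω (φ g) (φ g') := by
  obtain ⟨k, ⟨ho, rfl⟩ | ⟨ho, rfl⟩⟩ := hs
  · exact ⟨j k, .inl ⟨ho, by rw [h.gens_apply, map_mul]⟩⟩
  · exact ⟨j k, .inr ⟨ho, by rw [h.gens_apply, map_mul]⟩⟩

/-- Every edge of the subgraph induced on `V` is a loop, an edge of the Cayley graph of the factor,
or an edge of one of the attached translates of `W`. -/
lemma edge_cases {a : Γ} {i : ι} (ha : a ∈ V) (hb : a * f i ∈ V) :
    a = a * f i ∨ (∃ g k, a = φ g ∧ i = j k) ∨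
      ∃ g y, g ≠ 1 ∧ y ∈ W ∧ y * f i ∈ W ∧ a = φ g * y := by
  rcases (h.mem_iff a).1 ha with rfl | ⟨g, hg, y, hy, rfl⟩
  · rcases h.mul_mem i h.one_mem with ⟨-, k, rfl⟩ | hi
    · exact .inr (.inl ⟨1, k, by simp, rfl⟩)
    · exact .inl (h.eq_one_of_mem hb hi).symm
  · rcases h.mul_mem i hy with ⟨rfl, k, rfl⟩ | hi
    · exact .inr (.inl ⟨g, k, by simp, rfl⟩)
    · exact .inr (.inr ⟨g, y, hg, hy, hi, rfl⟩)

lemma step_cases {ω : Config (Γ × ι)} {a b : Γ} (hs : Step f ω a b) (ha : a ∈ V) (hb : b ∈ V) :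
    a = b ∨ (∃ g g', a = φ g ∧ b = φ g' ∧ Step f' (restrict φ j ω) g g') ∨
      ∃ g y y', g ≠ 1 ∧ y ∈ W ∧ y' ∈ W ∧ a = φ g * y ∧ b = φ g * y' ∧
        Step f (translate (φ g) ω) y y' := by
  obtain ⟨i, ⟨ho, rfl⟩ | ⟨ho, rfl⟩⟩ := hs
  · rcases h.edge_cases ha hb with he | ⟨g, k, rfl, rfl⟩ | ⟨g, y, hg, hy, hy', rfl⟩
    · exact .inl he
    · exact .inr (.inl ⟨g, g * f' k, rfl, by rw [h.gens_apply, map_mul], k, .inl ⟨ho, rfl⟩⟩)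
    · exact .inr (.inr ⟨g, y, y * f i, hg, hy, hy', rfl, by rw [mul_assoc], i, .inl ⟨ho, rfl⟩⟩)
  · rcases h.edge_cases hb ha with he | ⟨g, k, rfl, rfl⟩ | ⟨g, y, hg, hy, hy', rfl⟩
    · exact .inl he.symm
    · exact .inr (.inl ⟨g * f' k, g, by rw [h.gens_apply, map_mul], rfl, k, .inr ⟨ho, rfl⟩⟩)
    · exact .inr (.inr ⟨g, y * f i, y, hg, hy', hy, by rw [mul_assoc], rfl, i, .inr ⟨ho, rfl⟩⟩)

/-- The cluster in `V` consists of the cluster in the factor with the clusters in the attached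
translates of `W`. -/
lemma mem_clusterIn_iff {ω : Config (Γ × ι)} {x : Γ} :
    x ∈ clusterIn f V ω ↔ x = 1 ∨ ∃ g ∈ cluster f' (restrict φ j ω), g ≠ 1 ∧
      ∃ y ∈ clusterIn f W (translate (φ g) ω), x = φ g * y := by
  constructor
  · intro hx
    induction hx with
    | refl => exact .inl rfl
    | @tail a b _ hab ih =>
      obtain ⟨hs, ha, hb⟩ := hab
      rcases h.step_cases hs ha hb with rfl | ⟨g, g', rfl, rfl, hgg'⟩ |
        ⟨g, y, y', hg, hy, hy', rfl, rfl, hyy'⟩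
      · exact ih
      · have hgc : g ∈ cluster f' (restrict φ j ω) := by
          rcases ih with h1 | ⟨g₀, hg₀, -, y₀, hy₀, he⟩
          · rw [← map_one φ] at h1
            rw [h.injective h1]
            exact .refl
          · have hy₀W : y₀ ∈ W := by
              rcases hy₀.cases_tail with rfl | ⟨_, _, hy₀⟩
              exacts [h.one_mem, hy₀.2.2]
            rwa [h.eq_of_mul_eq (g := g) h.one_mem hy₀W (by simpa using he)]
        by_cases hg' : g' = 1
        · exact .inl (by simp [hg'])
        · exact .inr ⟨g', hgc.tail hgg', hg', 1, .refl, by simp⟩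
      · rcases ih with h1 | ⟨g₀, hg₀, -, y₀, hy₀, he⟩
        · exact absurd (h.eq_of_mul_eq hy h.one_mem (g' := 1) (by simpa using h1)) hg
        · have hy₀W : y₀ ∈ W := by
            rcases hy₀.cases_tail with rfl | ⟨_, _, hy₀⟩
            exacts [h.one_mem, hy₀.2.2]
          obtain rfl := h.eq_of_mul_eq hy hy₀W he
          obtain rfl := mul_left_cancel he
          exact .inr ⟨g, hg₀, hg, y', hy₀.tail ⟨hyy', hy, hy'⟩, rfl⟩
  · rintro (rfl | ⟨g, hgc, hg, y, hy, rfl⟩)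
    · exact .refl
    · have hφg : φ g ∈ clusterIn f V ω := by
        have := hgc.lift (p := fun a b => Step f ω a b ∧ a ∈ V ∧ b ∈ V) φ
          fun a b hab => ⟨h.restrict_step hab, h.map_mem_left a, h.map_mem_left b⟩
        rwa [Function.onFun, map_one] at this
      have := hy.lift (p := fun a b => Step f ω a b ∧ a ∈ V ∧ b ∈ V) (φ g * ·)
        fun a b hab => ⟨step_translate.1 hab.1, h.mul_mem_left hg hab.2.1,
          h.mul_mem_left hg hab.2.2⟩
      rw [Function.onFun, mul_one] at this
      exact hφg.trans this

lemma finite_clusterIn_iff {ω : Config (Γ × ι)} :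
    (clusterIn f V ω).Finite ↔ (cluster f' (restrict φ j ω)).Finite ∧
      ∀ g ∈ cluster f' (restrict φ j ω), g ≠ 1 →
        (clusterIn f W (translate (φ g) ω)).Finite := by
  constructor
  · intro hfin
    refine ⟨(hfin.preimage h.injective.injOn).subset fun g hg => ?_, fun g hgc hg => ?_⟩
    · refine h.mem_clusterIn_iff.2 ?_
      by_cases hg1 : g = 1
      · exact .inl (by simp [hg1])
      · exact .inr ⟨g, hg, hg1, 1, .refl, by simp⟩
    · exact (hfin.preimage (mul_right_injective (φ g)).injOn).subset fun y hy =>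
        h.mem_clusterIn_iff.2 (.inr ⟨g, hgc, hg, y, hy, rfl⟩)
  · rintro ⟨hc, hW⟩
    refine ((Set.finite_singleton (1 : Γ)).union ((hc.subset (Set.sep_subset _ (· ≠ 1))).biUnion
      fun g hg => (hW g hg.1 hg.2).image (φ g * ·))).subset fun x hx => ?_
    rcases h.mem_clusterIn_iff.1 hx with rfl | ⟨g, hgc, hg, y, hy, rfl⟩
    · exact .inl rfl
    · exact .inr (Set.mem_biUnion ⟨hgc, hg⟩ ⟨y, hy, rfl⟩)

/-- The cluster in `W` does not depend on the state of the edges joining `1` to its neighbours in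
the factor. -/
lemma clusterIn_mono {ω ω' : Config (Γ × ι)}
    (hω : ∀ y ∈ W, ∀ i, y ≠ 1 ∨ i ∉ Set.range j → ω (y, i) = ω' (y, i)) :
    clusterIn f W ω ⊆ clusterIn f W ω' := by
  have edge : ∀ a i, a ∈ W → a * f i ∈ W → ω (a, i) = true →
      a * f i = a ∨ ω' (a, i) = true := by
    intro a i ha hb ho
    by_cases hai : a ≠ 1 ∨ i ∉ Set.range j
    · exact .inr (hω a ha i hai ▸ ho)
    · push Not at hai
      obtain ⟨rfl, k, rfl⟩ := hai
      rw [h.gens_apply, one_mul] at hb ⊢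
      exact .inl (by rw [h.eq_one_of_map_mem hb, map_one])
  intro x hx
  induction hx with
  | refl => exact .refl
  | @tail a b _ hab ih =>
    obtain ⟨⟨i, ⟨ho, rfl⟩ | ⟨ho, rfl⟩⟩, ha, hb⟩ := hab
    · rcases edge a i ha hb ho with he | ho'
      · rwa [he]
      · exact ih.tail ⟨⟨i, .inl ⟨ho', rfl⟩⟩, ha, hb⟩
    · rcases edge b i hb ha ho with he | ho'
      · rwa [← he]
      · exact ih.tail ⟨⟨i, .inr ⟨ho', rfl⟩⟩, ha, hb⟩


/-- The set of edges that determine the cluster in the translate `φ g * W`, and, for `none`, the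
set of edges of the factor. -/
def edgesOf (φ : H →* Γ) (j : κ → ι) (W : Set Γ) : Option H → Set (Γ × ι)
  | none => {e | ∃ g k, e = (φ g, j k)}
  | some g => {e | ∃ y ∈ W, (y ≠ 1 ∨ e.2 ∉ Set.range j) ∧ e.1 = φ g * y}

lemma pairwise_disjoint_edgesOf :
    Pairwise (Function.onFun Disjoint (edgesOf φ j W)) := by
  have hnone : ∀ g, Disjoint (edgesOf φ j W none) (edgesOf φ j W (some g)) := by
    refine fun g => Set.disjoint_left.2 ?_
    rintro _ ⟨g', k, rfl⟩ ⟨y, hy, hyk, he⟩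
    obtain rfl := h.eq_of_mul_eq h.one_mem hy (g := g') (by simpa using he)
    have hy1 : y = 1 := by simpa using he
    simp [hy1] at hyk
  rintro (_ | g) (_ | g') hne
  · exact absurd rfl hne
  · exact hnone g'
  · exact (hnone g).symm
  · refine Set.disjoint_left.2 ?_
    rintro _ ⟨y, hy, -, he⟩ ⟨y', hy', -, he'⟩
    exact hne (congrArg some (h.eq_of_mul_eq hy hy' (he.symm.trans he')))

section Probability

variable [Countable Γ] [Countable H] [Countable ι] [Countable κ]
  {ν : Measure Bool} [IsProbabilityMeasure ν]

/-- The factor cluster and the clusters in the attached translates of `W` are independent. -/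
lemma measure_cluster_eq_inter [DecidableEq H] (K : Finset H) :
    Measure.infinitePi (fun _ : Γ × ι => ν) {ω | cluster f' (restrict φ j ω) = K ∧
        ∀ g ∈ K, g ≠ 1 → (clusterIn f W (translate (φ g) ω)).Finite} =
      Measure.infinitePi (fun _ : H × κ => ν) {ω | cluster f' ω = K} *
        Measure.infinitePi (fun _ : Γ × ι => ν) {ω | (clusterIn f W ω).Finite} ^
          (K.filter (· ≠ 1)).card := by
  have hpres : MeasurePreserving (restrict φ j)
      (Measure.infinitePi (fun _ : Γ × ι => ν)) (Measure.infinitePi (fun _ : H × κ => ν)) :=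
    measurePreserving_reindex (u := fun e : H × κ => (φ e.1, j e.2)) fun e e' hee' =>
      Prod.ext (h.injective (Prod.ext_iff.1 hee').1) (h.gens_injective (Prod.ext_iff.1 hee').2)
  have hpres' : ∀ x : Γ, MeasurePreserving (translate x)
      (Measure.infinitePi (fun _ : Γ × ι => ν)) (Measure.infinitePi (fun _ : Γ × ι => ν)) :=
    fun x => measurePreserving_reindex (u := fun e : Γ × ι => (x * e.1, e.2)) fun e e' hee' =>
      Prod.ext (mul_left_cancel (Prod.ext_iff.1 hee').1) (Prod.ext_iff.1 hee').2
  have hK : MeasurableSet {ω : Config (H × κ) | cluster f' ω = K} :=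
    measurableSet_eq_of_mem (measurableSet_mem_cluster f') _
  have hW : MeasurableSet {ω : Config (Γ × ι) | (clusterIn f W ω).Finite} :=
    measurableSet_finite_of_mem (measurableSet_mem_clusterIn f W)
  let D : Option H → Set (Config (Γ × ι)) := fun o => o.elim
    (restrict φ j ⁻¹' {ω | cluster f' ω = K})
    (fun g => translate (φ g) ⁻¹' {ω | (clusterIn f W ω).Finite})
  have hD : ∀ o, MeasurableSet (D o) := by
    rintro (_ | g)
    · exact hpres.measurable hK
    · exact (hpres' (φ g)).measurable hW
  have hdep : ∀ o, ∀ ω ω' : Config (Γ × ι), (∀ e ∈ edgesOf φ j W o, ω e = ω' e) →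
      ω ∈ D o → ω' ∈ D o := by
    rintro (_ | g) ω ω' he hω
    · have : restrict φ j ω = restrict φ j ω' := funext fun e => he _ ⟨e.1, e.2, rfl⟩
      change cluster f' (restrict φ j ω') = K
      rw [← this]
      exact hω
    · exact Set.Finite.subset hω
        (h.clusterIn_mono fun y hy i hyi => (he (φ g * y, i) ⟨y, hy, hyi, rfl⟩).symm)
  have key := infinitePi_biInter_of_disjoint (ν := ν) h.pairwise_disjoint_edgesOf hD hdep
    (insert none ((K.filter (· ≠ 1)).map Function.Embedding.some))
  rw [Finset.prod_insert (by simp), Finset.prod_map] at key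
  have h0 : Measure.infinitePi (fun _ : Γ × ι => ν) (D none) =
      Measure.infinitePi (fun _ : H × κ => ν) {ω | cluster f' ω = K} :=
    hpres.measure_preimage hK.nullMeasurableSet
  have h1 : ∀ g, Measure.infinitePi (fun _ : Γ × ι => ν) (D (some g)) =
      Measure.infinitePi (fun _ : Γ × ι => ν) {ω | (clusterIn f W ω).Finite} :=
    fun g => (hpres' (φ g)).measure_preimage hW.nullMeasurableSet
  simp only [Function.Embedding.some_apply, h0, h1, Finset.prod_const] at key
  rw [← key]
  congr 1
  ext ω
  simp [D]

lemma measure_finite_clusterIn :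
    Measure.infinitePi (fun _ : Γ × ι => ν) {ω | (clusterIn f V ω).Finite} =
      ∑' n : ℕ, Measure.infinitePi (fun _ : Γ × ι => ν) {ω | (clusterIn f W ω).Finite} ^ n *
        Measure.infinitePi (fun _ : H × κ => ν)
          {ω | (cluster f' ω).encard = ((n + 1 : ℕ) : ℕ∞)} := by
  classical
  set b := Measure.infinitePi (fun _ : Γ × ι => ν) {ω | (clusterIn f W ω).Finite}
  set m := Measure.infinitePi (fun _ : H × κ => ν)
  have hK : ∀ K : Finset H, MeasurableSet {ω : Config (H × κ) | cluster f' ω = K} :=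
    fun K => measurableSet_eq_of_mem (measurableSet_mem_cluster f') _
  have hmeas : ∀ K : Finset H, MeasurableSet {ω : Config (Γ × ι) |
      cluster f' (restrict φ j ω) = K ∧
        ∀ g ∈ K, g ≠ 1 → (clusterIn f W (translate (φ g) ω)).Finite} := by
    intro K
    have hr : Measurable (restrict φ j : Config (Γ × ι) → Config (H × κ)) :=
      measurable_pi_iff.2 fun e => measurable_pi_apply _
    have ht : ∀ x : Γ, Measurable (translate x : Config (Γ × ι) → Config (Γ × ι)) :=
      fun x => measurable_pi_iff.2 fun e => measurable_pi_apply _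
    have : {ω : Config (Γ × ι) | cluster f' (restrict φ j ω) = K ∧
        ∀ g ∈ K, g ≠ 1 → (clusterIn f W (translate (φ g) ω)).Finite} =
        restrict φ j ⁻¹' {ω | cluster f' ω = K} ∩ ⋂ g ∈ K.filter (· ≠ 1),
          translate (φ g) ⁻¹' {ω | (clusterIn f W ω).Finite} := by
      ext ω
      simp
    rw [this]
    exact (hr (hK K)).inter (Finset.measurableSet_biInter _ fun g _ =>
      ht _ (measurableSet_finite_of_mem (measurableSet_mem_clusterIn f W)))
  have hV : {ω : Config (Γ × ι) | (clusterIn f V ω).Finite} = ⋃ K : Finset H,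
      {ω | cluster f' (restrict φ j ω) = K ∧
        ∀ g ∈ K, g ≠ 1 → (clusterIn f W (translate (φ g) ω)).Finite} := by
    ext ω
    simp only [Set.mem_ofPred_eq, Set.mem_iUnion, h.finite_clusterIn_iff]
    constructor
    · rintro ⟨hfin, hg⟩
      exact ⟨hfin.toFinset, by simp, fun g hgc => hg g (hfin.mem_toFinset.1 hgc)⟩
    · rintro ⟨K, hcK, hg⟩
      rw [hcK]
      exact ⟨K.finite_toSet, fun g hgc => hg g hgc⟩
  rw [hV, measure_iUnion ?_ hmeas]
  swap
  · refine fun K K' hne => Set.disjoint_left.2 fun ω hω hω' => hne ?_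
    exact Finset.coe_injective (hω.1.symm.trans hω'.1)
  have hcard : ∀ n : ℕ, m {ω | (cluster f' ω).encard = ((n + 1 : ℕ) : ℕ∞)} =
      ∑' K : Finset H, if K.card = n + 1 then m {ω | cluster f' ω = K} else 0 := by
    intro n
    have : {ω : Config (H × κ) | (cluster f' ω).encard = ((n + 1 : ℕ) : ℕ∞)} =
        ⋃ K : Finset H, if K.card = n + 1 then {ω | cluster f' ω = K} else ∅ := by
      ext ω
      simp only [Set.mem_ofPred_eq, Set.mem_iUnion]
      constructor
      · intro hn
        have hfin := Set.finite_of_encard_eq_coe hn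
        refine ⟨hfin.toFinset, ?_⟩
        rw [hfin.encard_eq_coe_toFinset_card] at hn
        rw [if_pos (by exact_mod_cast hn)]
        simp
      · rintro ⟨K, hωK⟩
        split_ifs at hωK with hc
        · have hωK : cluster f' ω = K := hωK
          rw [hωK, Set.encard_coe_eq_coe_finsetCard, hc]
        · exact hωK.elim
    rw [this, measure_iUnion]
    · exact tsum_congr fun K => by split_ifs <;> simp
    · intro K K' hne
      simp only [Function.onFun]
      split_ifs <;> try simp
      exact Set.disjoint_left.2 fun ω hω hω' => hne (Finset.coe_injective (hω.symm.trans hω'))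
    · intro K
      split_ifs
      exacts [hK K, MeasurableSet.empty]
  simp_rw [hcard, ← ENNReal.tsum_mul_left]
  rw [ENNReal.tsum_comm]
  refine tsum_congr fun K => ?_
  rw [h.measure_cluster_eq_inter]
  by_cases h1 : (1 : H) ∈ K
  · have hc : K.card = (K.filter (· ≠ 1)).card + 1 := by
      rw [Finset.filter_ne', Finset.card_erase_add_one h1]
    rw [tsum_eq_single (K.filter (· ≠ 1)).card fun n hn => by rw [if_neg (by omega), mul_zero],
      if_pos hc, mul_comm]
  · have : {ω : Config (H × κ) | cluster f' ω = K} = ∅ := by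
      ext ω
      simp only [Set.mem_ofPred_eq, Set.mem_empty_iff_false, iff_false]
      intro hω
      have : (1 : H) ∈ cluster f' ω := Relation.ReflTransGen.refl
      rw [hω] at this
      exact h1 this
    simp [this]

/-- The probability that the cluster in `V` is infinite is given by the walk-through function of
the factor. -/
theorem measure_infinite_clusterIn {p : ℝ} (hp : p ∈ Set.Icc (0 : ℝ) 1)
    {μ : Measure (Config (Γ × ι))} {μ' : Measure (Config (H × κ))}
    (hμ : IsBernoulli p μ) (hμ' : IsBernoulli p μ') :
    (μ {ω | (clusterIn f V ω).Infinite}).toReal =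
      wt f' μ' (μ {ω | (clusterIn f W ω).Infinite}).toReal := by
  have := isProbabilityMeasure_edgeLaw hp
  rw [hμ.eq_infinitePi, hμ'.eq_infinitePi]
  have hcompl : ∀ U : Set Γ,
      (Measure.infinitePi (fun _ : Γ × ι => edgeLaw p) {ω | (clusterIn f U ω).Infinite}).toReal =
      1 - (Measure.infinitePi (fun _ : Γ × ι => edgeLaw p)
        {ω | (clusterIn f U ω).Finite}).toReal :=
    fun U => probReal_compl_eq_one_sub
      (measurableSet_finite_of_mem (measurableSet_mem_clusterIn f U))
  rw [hcompl, hcompl, h.measure_finite_clusterIn, wt,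
    ENNReal.tsum_toReal_eq fun n => ENNReal.mul_ne_top (ENNReal.pow_ne_top (measure_ne_top _ _))
      (measure_ne_top _ _)]
  simp [ENNReal.toReal_mul]

end Probability

end TreeDecomposition

end TreeDecomposition

section FreeProduct

open Monoid (Coprod CoprodI)

universe u v

variable {G₁ : Type u} {G₂ : Type v} [Group G₁] [Group G₂]

/-- The image of a syllable in the free product. -/
def syl : G₁ ⊕ G₂ → Coprod G₁ G₂ :=
  Sum.elim (fun g => Coprod.inl g) (fun h => Coprod.inr h)

/-- A list of syllables is reduced if it is an alternating sequence of nontrivial syllables. -/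
def Reduced (l : List (G₁ ⊕ G₂)) : Prop :=
  (∀ a ∈ l, a ≠ Sum.inl 1 ∧ a ≠ Sum.inr 1) ∧ l.IsChain (fun a b => a.isLeft ≠ b.isLeft)

/-- The elements of the free product that are trivial or whose normal form begins with a syllable
in the first (for `c = true`) or second (for `c = false`) factor. -/
def side (G₁ : Type u) (G₂ : Type v) [Group G₁] [Group G₂] (c : Bool) : Set (Coprod G₁ G₂) :=
  {x | ∃ l, Reduced l ∧ (∀ a ∈ l.head?, a.isLeft = c) ∧ sylProd l = x}

lemma sylProd_nil : sylProd ([] : List (G₁ ⊕ G₂)) = 1 := rfl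

lemma sylProd_cons (a : G₁ ⊕ G₂) (l : List (G₁ ⊕ G₂)) : sylProd (a :: l) = syl a * sylProd l := by
  simp [sylProd, syl]

lemma reduced_nil : Reduced ([] : List (G₁ ⊕ G₂)) := ⟨by simp, .nil⟩

lemma reduced_cons {a : G₁ ⊕ G₂} {l : List (G₁ ⊕ G₂)} :
    Reduced (a :: l) ↔ (a ≠ Sum.inl 1 ∧ a ≠ Sum.inr 1) ∧ (∀ b ∈ l.head?, b.isLeft = !a.isLeft) ∧
      Reduced l := by
  simp only [Reduced, List.forall_mem_cons, List.isChain_cons, Bool.eq_not, ne_comm (a := a.isLeft)]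
  tauto

lemma one_mem_side (c : Bool) : 1 ∈ side G₁ G₂ c := ⟨[], reduced_nil, by simp, sylProd_nil⟩

lemma insert_beginsLeft : insert 1 {x : Coprod G₁ G₂ | beginsLeft x} = side G₁ G₂ true := by
  ext x
  constructor
  · rintro (rfl | ⟨l, -, hne, hch, ⟨g, hg⟩, rfl⟩)
    · exact one_mem_side _
    · exact ⟨l, ⟨hne, hch⟩, by simp [hg], rfl⟩
  · rintro ⟨_ | ⟨g | g, l⟩, ⟨hne, hch⟩, hl, rfl⟩
    · exact .inl rfl
    · exact .inr ⟨_, by simp, hne, hch, ⟨g, rfl⟩, rfl⟩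
    · simp at hl

lemma insert_beginsRight : insert 1 {x : Coprod G₁ G₂ | beginsRight x} = side G₁ G₂ false := by
  ext x
  constructor
  · rintro (rfl | ⟨l, -, hne, hch, ⟨g, hg⟩, rfl⟩)
    · exact one_mem_side _
    · exact ⟨l, ⟨hne, hch⟩, by simp [hg], rfl⟩
  · rintro ⟨_ | ⟨g | g, l⟩, ⟨hne, hch⟩, hl, rfl⟩
    · exact .inl rfl
    · simp at hl
    · exact .inr ⟨_, by simp, hne, hch, ⟨g, rfl⟩, rfl⟩

lemma mem_side_iff {c : Bool} {x : Coprod G₁ G₂} :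
    x ∈ side G₁ G₂ c ↔ x = 1 ∨ ∃ a : G₁ ⊕ G₂, (a ≠ Sum.inl 1 ∧ a ≠ Sum.inr 1) ∧ a.isLeft = c ∧
      ∃ y ∈ side G₁ G₂ (!c), x = syl a * y := by
  constructor
  · rintro ⟨_ | ⟨a, l⟩, hl, hc, rfl⟩
    · exact .inl rfl
    · obtain ⟨ha, hal, hl⟩ := reduced_cons.1 hl
      obtain rfl : a.isLeft = c := hc a rfl
      exact .inr ⟨a, ha, rfl, sylProd l, ⟨l, hl, hal, rfl⟩, sylProd_cons a l⟩
  · rintro (rfl | ⟨a, ha, rfl, _, ⟨l, hl, hal, rfl⟩, rfl⟩)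
    · exact one_mem_side _
    · exact ⟨a :: l, reduced_cons.2 ⟨ha, hal, hl⟩, by simp, sylProd_cons a l⟩

lemma syl_mem_side (s : G₁ ⊕ G₂) : syl s ∈ side G₁ G₂ s.isLeft := by
  by_cases hs : s ≠ Sum.inl 1 ∧ s ≠ Sum.inr 1
  · exact mem_side_iff.2 (.inr ⟨s, hs, rfl, 1, one_mem_side _, by simp⟩)
  · rw [not_and_or, not_not, not_not] at hs
    rcases hs with rfl | rfl <;> simpa [syl] using one_mem_side _

lemma exists_syl_mul {a s : G₁ ⊕ G₂} (h : s.isLeft = a.isLeft) :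
    ∃ b : G₁ ⊕ G₂, b.isLeft = a.isLeft ∧ syl a * syl s = syl b := by
  rcases a with a | a <;> rcases s with s | s <;> simp at h
  · exact ⟨.inl (a * s), rfl, by simp [syl]⟩
  · exact ⟨.inr (a * s), rfl, by simp [syl]⟩

lemma sylProd_mul_syl_mem_side {l : List (G₁ ⊕ G₂)} (hl : Reduced l) {c : Bool}
    (hc : ∀ a ∈ l.head?, a.isLeft = c) (s : G₁ ⊕ G₂) (hs : l = [] → s.isLeft = c) :
    sylProd l * syl s ∈ side G₁ G₂ c := by
  induction l generalizing c with
  | nil => simpa [sylProd_nil, ← hs rfl] using syl_mem_side s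
  | cons a l ih =>
    obtain ⟨ha, hal, hl⟩ := reduced_cons.1 hl
    obtain rfl : a.isLeft = c := hc a rfl
    by_cases h : l = [] ∧ s.isLeft = a.isLeft
    · obtain ⟨b, hb, hab⟩ := exists_syl_mul h.2
      rw [h.1, sylProd_cons, sylProd_nil, mul_one, hab, ← hb]
      exact syl_mem_side b
    · rw [sylProd_cons, mul_assoc]
      refine mem_side_iff.2 (.inr ⟨a, ha, rfl, _, ih hl hal fun h' => ?_, rfl⟩)
      exact Bool.eq_not.2 fun h'' => h ⟨h', h''⟩

lemma mul_syl_mem_side {c : Bool} {x : Coprod G₁ G₂} (hx : x ∈ side G₁ G₂ c) (s : G₁ ⊕ G₂) :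
    (x = 1 ∧ s.isLeft = !c) ∨ x * syl s ∈ side G₁ G₂ c := by
  obtain ⟨l, hl, hc, rfl⟩ := hx
  by_cases h : l = [] ∧ s.isLeft = !c
  · exact .inl ⟨by rw [h.1, sylProd_nil], h.2⟩
  · exact .inr (sylProd_mul_syl_mem_side hl hc s fun h' => by
      simpa [h'] using h)

/-- The two factors as a family of groups in a common universe. -/
def Factor (G₁ : Type u) (G₂ : Type v) : Bool → Type (max u v)
  | true => ULift.{v} G₁
  | false => ULift.{u} G₂

instance (b : Bool) : Group (Factor G₁ G₂ b) :=
  match b with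
  | true => inferInstanceAs (Group (ULift.{v} G₁))
  | false => inferInstanceAs (Group (ULift.{u} G₂))

/-- A syllable as a letter of a word in the indexed free product. -/
def letter : G₁ ⊕ G₂ → Σ b, Factor G₁ G₂ b
  | .inl g => ⟨true, ULift.up g⟩
  | .inr g => ⟨false, ULift.up g⟩

omit [Group G₁] [Group G₂] in
lemma letter_fst (a : G₁ ⊕ G₂) : (letter a).1 = a.isLeft := by cases a <;> rfl

omit [Group G₁] [Group G₂] in
lemma letter_injective : Function.Injective (letter : G₁ ⊕ G₂ → Σ b, Factor G₁ G₂ b) := by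
  rintro (a | a) (b | b) h
  · obtain ⟨-, h⟩ := Sigma.mk.inj_iff.1 h
    exact congrArg Sum.inl (ULift.up_injective (eq_of_heq h))
  · exact absurd (congrArg Sigma.fst h) (by simp [letter])
  · exact absurd (congrArg Sigma.fst h) (by simp [letter])
  · obtain ⟨-, h⟩ := Sigma.mk.inj_iff.1 h
    exact congrArg Sum.inr (ULift.up_injective (eq_of_heq h))

lemma letter_snd_ne_one {a : G₁ ⊕ G₂} (ha : a ≠ Sum.inl 1 ∧ a ≠ Sum.inr 1) :
    (letter a).2 ≠ 1 := by
  rcases a with a | a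
  · exact fun h => ha.1 (congrArg Sum.inl (congrArg ULift.down h))
  · exact fun h => ha.2 (congrArg Sum.inr (congrArg ULift.down h))

/-- The word in the indexed free product given by a reduced list of syllables. -/
def Reduced.toWord {l : List (G₁ ⊕ G₂)} (hl : Reduced l) : CoprodI.Word (Factor G₁ G₂) where
  toList := l.map letter
  ne_one := by
    simp only [List.mem_map, forall_exists_index, and_imp, forall_apply_eq_imp_iff₂]
    exact fun a ha => letter_snd_ne_one (hl.1 a ha)
  chain_ne := by
    rw [List.isChain_map]
    simpa only [letter_fst] using hl.2

/-- The map from the binary to the indexed free product. -/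
def toCoprodI : Coprod G₁ G₂ →* CoprodI (Factor G₁ G₂) :=
  Coprod.lift
    ((CoprodI.of (M := Factor G₁ G₂) (i := true)).comp
      (MulEquiv.ulift.symm : G₁ ≃* ULift.{v} G₁).toMonoidHom)
    ((CoprodI.of (M := Factor G₁ G₂) (i := false)).comp
      (MulEquiv.ulift.symm : G₂ ≃* ULift.{u} G₂).toMonoidHom)

lemma toCoprodI_syl (a : G₁ ⊕ G₂) : toCoprodI (syl a) = CoprodI.of (letter a).2 := by
  rcases a with a | a
  · exact Coprod.lift_apply_inl _ _ _
  · exact Coprod.lift_apply_inr _ _ _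

lemma Reduced.prod_toWord {l : List (G₁ ⊕ G₂)} (hl : Reduced l) :
    hl.toWord.prod = toCoprodI (sylProd l) := by
  change ((l.map letter).map fun a => CoprodI.of a.2).prod = _
  clear hl
  induction l with
  | nil => simp [sylProd_nil]
  | cons a l ih => simp [sylProd_cons, toCoprodI_syl, ← ih]

/-- Uniqueness of the normal form in the free product. -/
lemma Reduced.eq_of_sylProd_eq {l l' : List (G₁ ⊕ G₂)} (hl : Reduced l) (hl' : Reduced l')
    (h : sylProd l = sylProd l') : l = l' := by
  classical
  have : hl.toWord = hl'.toWord := CoprodI.Word.equiv.symm.injective <| by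
    change hl.toWord.prod = hl'.toWord.prod
    rw [hl.prod_toWord, hl'.prod_toWord, h]
  exact letter_injective.list_map (congrArg CoprodI.Word.toList this)

lemma syl_mul_notMem_side {c : Bool} {a : G₁ ⊕ G₂} (ha : a ≠ Sum.inl 1 ∧ a ≠ Sum.inr 1)
    (hac : a.isLeft = !c) {y : Coprod G₁ G₂} (hy : y ∈ side G₁ G₂ c) :
    syl a * y ∉ side G₁ G₂ c := by
  rintro ⟨l', hl', hc', he⟩
  obtain ⟨l, hl, hc, rfl⟩ := hy
  rw [← sylProd_cons] at he
  obtain rfl := hl'.eq_of_sylProd_eq (reduced_cons.2 ⟨ha, by simpa [hac] using hc, hl⟩) he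
  simp [hac] at hc'

variable (S₁ : Set G₁) (S₂ : Set G₂)

lemma coprodGens_eq_syl (i : S₁ ⊕ S₂) :
    coprodGens S₁ S₂ i = syl (Sum.map Subtype.val Subtype.val i) := by
  cases i <;> rfl

lemma treeDecomposition_left : TreeDecomposition (coprodGens S₁ S₂) (setGens S₁)
    (Coprod.inl : G₁ →* Coprod G₁ G₂) Sum.inl (side G₁ G₂ true) (side G₁ G₂ false) where
  gens_apply _ := rfl
  gens_injective := Sum.inl_injective
  one_mem := one_mem_side _
  mem_iff x := by
    rw [mem_side_iff]
    simp [syl]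
  eq_of_mul_eq {g g' y y'} hy hy' he := by
    by_contra hne
    refine syl_mul_notMem_side (a := .inl (g'⁻¹ * g)) ⟨?_, by simp⟩ rfl hy ?_
    · simpa [inv_mul_eq_one] using Ne.symm hne
    · simpa [syl, mul_assoc, he] using hy'
  mul_mem {y} i hy := by
    rw [coprodGens_eq_syl]
    refine (mul_syl_mem_side hy _).imp_left (And.imp_right fun hi => ?_)
    rcases i with i | i
    · exact ⟨i, rfl⟩
    · simp at hi

lemma treeDecomposition_right : TreeDecomposition (coprodGens S₁ S₂) (setGens S₂)
    (Coprod.inr : G₂ →* Coprod G₁ G₂) Sum.inr (side G₁ G₂ false) (side G₁ G₂ true) where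
  gens_apply _ := rfl
  gens_injective := Sum.inr_injective
  one_mem := one_mem_side _
  mem_iff x := by
    rw [mem_side_iff]
    simp [syl]
  eq_of_mul_eq {g g' y y'} hy hy' he := by
    by_contra hne
    refine syl_mul_notMem_side (a := .inr (g'⁻¹ * g)) ⟨by simp, ?_⟩ rfl hy ?_
    · simpa [inv_mul_eq_one] using Ne.symm hne
    · simpa [syl, mul_assoc, he] using hy'
  mul_mem {y} i hy := by
    rw [coprodGens_eq_syl]
    refine (mul_syl_mem_side hy _).imp_left (And.imp_right fun hi => ?_)
    rcases i with i | i
    · simp at hi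
    · exact ⟨i, rfl⟩

lemma countable_of_closure_eq_top {G : Type*} [Group G] {S : Set G} (hS : S.Countable)
    (hgen : Subgroup.closure S = ⊤) : Countable G := by
  have := hS.to_subtype
  rw [FreeGroup.closure_eq_range, MonoidHom.range_eq_top] at hgen
  exact hgen.countable

lemma countable_coprod [Countable G₁] [Countable G₂] : Countable (Coprod G₁ G₂) :=
  have : Countable (FreeMonoid (G₁ ⊕ G₂)) := inferInstanceAs (Countable (List (G₁ ⊕ G₂)))
  Coprod.mk_surjective.countable

end FreeProduct

end Perc

/-- In the Cayley graph of `G₁ * G₂` (w.r.t. `S₁ ⊔ S₂`), let `A(p)`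
(resp. `B(p)`) be the probability that the cluster of the identity in the subgraph
induced on `{e} ∪ P₁` (resp. `{e} ∪ P₂`) is infinite, where `Pᵢ` is the set of
nontrivial elements whose normal form begins with a nontrivial syllable of `Gᵢ`.  Then
for every `p ∈ [0,1]`: `A(p) = g₁(p, B(p))` and `B(p) = g₂(p, A(p))`. -/
theorem infinite_path_probability_recursion
    {G₁ G₂ : Type*} [Group G₁] [Group G₂] [Nontrivial G₁] [Nontrivial G₂]
    (S₁ : Set G₁) (S₂ : Set G₂) (hfin₁ : S₁.Finite) (hfin₂ : S₂.Finite)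
    (hgen₁ : Subgroup.closure S₁ = ⊤) (hgen₂ : Subgroup.closure S₂ = ⊤)
    (μ₁ : ℝ → Measure (Config (G₁ × S₁))) (μ₂ : ℝ → Measure (Config (G₂ × S₂)))
    (μ : ℝ → Measure (Config (Monoid.Coprod G₁ G₂ × (S₁ ⊕ S₂))))
    (hμ₁ : ∀ p ∈ Set.Icc (0 : ℝ) 1, IsBernoulli p (μ₁ p))
    (hμ₂ : ∀ p ∈ Set.Icc (0 : ℝ) 1, IsBernoulli p (μ₂ p))
    (hμ : ∀ p ∈ Set.Icc (0 : ℝ) 1, IsBernoulli p (μ p))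
    (p : ℝ) (hp : p ∈ Set.Icc (0 : ℝ) 1) :
    (μ p {ω | (clusterIn (coprodGens S₁ S₂) (insert 1 {x | beginsLeft x}) ω).Infinite}).toReal
      = wt (setGens S₁) (μ₁ p)
          ((μ p {ω | (clusterIn (coprodGens S₁ S₂) (insert 1 {x | beginsRight x}) ω).Infinite}).toReal) ∧
    (μ p {ω | (clusterIn (coprodGens S₁ S₂) (insert 1 {x | beginsRight x}) ω).Infinite}).toReal
      = wt (setGens S₂) (μ₂ p)
          ((μ p {ω | (clusterIn (coprodGens S₁ S₂) (insert 1 {x | beginsLeft x}) ω).Infinite}).toReal) := by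
  have := countable_of_closure_eq_top hfin₁.countable hgen₁
  have := countable_of_closure_eq_top hfin₂.countable hgen₂
  have := hfin₁.countable.to_subtype
  have := hfin₂.countable.to_subtype
  have := countable_coprod (G₁ := G₁) (G₂ := G₂)
  rw [insert_beginsLeft, insert_beginsRight]
  exact ⟨(treeDecomposition_left S₁ S₂).measure_infinite_clusterIn hp (hμ p hp) (hμ₁ p hp),
    (treeDecomposition_right S₁ S₂).measure_infinite_clusterIn hp (hμ p hp) (hμ₂ p hp)⟩
end

section
/- Let G = C₂ * C₃ be the free product of the cyclic groups of orders 2 and 3 (isomorphic to the modular group PSL₂(ℤ)), with generating set {a, b} where a is the generator of C₂ and b the generator of C₃. Then the polynomial 2x⁵ − 6x⁴ + 2x³ + 4x² − 1 has exactly one root in the open interval (0,1), and the critical probability p_c of the Cayley graph of G with respect to {a,b} equals this root. -/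
open MeasureTheory ENNReal

namespace Perc

open ProbabilityTheory Filter
open scoped Topology

/-- The expected number of grandchildren reached through an `a`-edge and a `b`-triangle. -/
def offspringMean (p : ℝ) : ℝ := 2 * (2 * p - p ^ 2) * (p + p ^ 2 - p ^ 3)

/-- The probability that a vertex is joined to both of its grandchildren. -/
def offspringBoth (p : ℝ) : ℝ := (2 * p - p ^ 2) * (3 * p ^ 2 - 2 * p ^ 3)

lemma offspringMean_strictMonoOn : StrictMonoOn offspringMean (Set.Icc 0 1) := by
  apply strictMonoOn_of_deriv_pos (convex_Icc 0 1)
  · unfold offspringMean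
    fun_prop
  · intro x hx
    rw [interior_Icc] at hx
    obtain ⟨h0, h1⟩ := hx
    have hd : HasDerivAt offspringMean
        (2 * (2 - 2 * x) * (x + x ^ 2 - x ^ 3) +
          2 * (2 * x - x ^ 2) * (1 + 2 * x - 3 * x ^ 2)) x := by
      have h₁ : HasDerivAt (fun x : ℝ => 2 * (2 * x - x ^ 2)) (2 * (2 - 2 * x)) x := by
        simpa using (((hasDerivAt_id x).const_mul 2).sub (hasDerivAt_pow 2 x)).const_mul 2
      have h₂ : HasDerivAt (fun x : ℝ => x + x ^ 2 - x ^ 3) (1 + 2 * x - 3 * x ^ 2) x := by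
        exact (((hasDerivAt_id x).add (hasDerivAt_pow 2 x)).sub (hasDerivAt_pow 3 x)).congr_deriv
          (by simp)
      exact h₁.mul h₂
    rw [hd.deriv]
    have h : 2 * (2 - 2 * x) * (x + x ^ 2 - x ^ 3) + 2 * (2 * x - x ^ 2) * (1 + 2 * x - 3 * x ^ 2)
        = 2 * x * (1 - x) * (4 + 7 * x - 5 * x ^ 2) := by ring
    rw [h]
    have : 0 < 4 + 7 * x - 5 * x ^ 2 := by nlinarith
    have : 0 < 1 - x := by linarith
    positivity

lemma offspringMean_eq_one_iff (x : ℝ) :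
    offspringMean x = 1 ↔ 2 * x ^ 5 - 6 * x ^ 4 + 2 * x ^ 3 + 4 * x ^ 2 - 1 = 0 := by
  unfold offspringMean
  constructor <;> intro h <;> linarith

lemma exists_offspringMean_eq_one : ∃ x ∈ Set.Ioo (0 : ℝ) 1, offspringMean x = 1 := by
  have hc : ContinuousOn offspringMean (Set.Icc 0 1) := by
    unfold offspringMean
    fun_prop
  obtain ⟨x, hx, h⟩ := intermediate_value_Ioo zero_le_one hc
    (show (1 : ℝ) ∈ Set.Ioo _ _ by norm_num [offspringMean])
  exact ⟨x, hx, h⟩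

section Reach

variable {Ω : Type*} (U : List Bool × Fin 5 → Set Ω)

/-- Connection across the pair of parallel `a`-edges. -/
def crossing (w : List Bool) : Set Ω := U (w, 0) ∪ U (w, 1)

/-- Connection, inside a `b`-triangle, of the entry vertex to the vertex selected by the
Boolean. -/
def triangle (w : List Bool) : Bool → Set Ω
  | true => U (w, 2) ∪ (U (w, 4) ∩ U (w, 3))
  | false => U (w, 4) ∪ (U (w, 2) ∩ U (w, 3))

/-- The event that the open cluster, explored from the node `w` of the binary tree towards
its descendants, reaches `n` further generations. -/
def reach : ℕ → List Bool → Set Ω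
  | 0, _ => Set.univ
  | n + 1, w => crossing U w ∩
      ((triangle U w true ∩ reach n (true :: w)) ∪ (triangle U w false ∩ reach n (false :: w)))

lemma reach_antitone (w : List Bool) : Antitone fun n => reach U n w := by
  refine antitone_nat_of_succ_le fun n => ?_
  induction n generalizing w with
  | zero => exact Set.subset_univ _
  | succ n ih =>
    exact Set.inter_subset_inter_right _ (Set.union_subset_union
      (Set.inter_subset_inter_right _ (ih _)) (Set.inter_subset_inter_right _ (ih _)))

/-- The σ-algebra generated by the events with index in `S`. -/
abbrev sigmaOf (S : Set (List Bool × Fin 5)) : MeasurableSpace Ω :=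
  ⨆ i ∈ S, MeasurableSpace.generateFrom {U i}

lemma measurableSet_sigmaOf {S : Set (List Bool × Fin 5)} {i : List Bool × Fin 5} (hi : i ∈ S) :
    MeasurableSet[sigmaOf U S] (U i) := by
  have h : MeasurableSpace.generateFrom {U i} ≤ sigmaOf U S :=
    le_iSup₂ (f := fun i (_ : i ∈ S) => MeasurableSpace.generateFrom {U i}) i hi
  exact h _ (MeasurableSpace.measurableSet_generateFrom rfl)

lemma sigmaOf_mono {S T : Set (List Bool × Fin 5)} (h : S ⊆ T) : sigmaOf U S ≤ sigmaOf U T :=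
  biSup_mono h

lemma measurableSet_crossing {w : List Bool} {S : Set (List Bool × Fin 5)}
    (h₀ : (w, 0) ∈ S) (h₁ : (w, 1) ∈ S) : MeasurableSet[sigmaOf U S] (crossing U w) :=
  MeasurableSet.union (m := sigmaOf U S)
    (measurableSet_sigmaOf U h₀) (measurableSet_sigmaOf U h₁)

lemma measurableSet_triangle {w : List Bool} {S : Set (List Bool × Fin 5)}
    (h₂ : (w, 2) ∈ S) (h₃ : (w, 3) ∈ S) (h₄ : (w, 4) ∈ S) (ε : Bool) :
    MeasurableSet[sigmaOf U S] (triangle U w ε) := by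
  have m₂ := measurableSet_sigmaOf U h₂
  have m₃ := measurableSet_sigmaOf U h₃
  have m₄ := measurableSet_sigmaOf U h₄
  cases ε
  · exact m₄.union (m₂.inter m₃)
  · exact m₂.union (m₄.inter m₃)

/-- The indices of the edges lying beyond the node `w`. -/
def beyond (w : List Bool) : Set (List Bool × Fin 5) := {i | w <:+ i.1}

lemma beyond_cons_subset (ε : Bool) (w : List Bool) : beyond (ε :: w) ⊆ beyond w :=
  fun _ hi => (List.suffix_cons ε w).trans hi

lemma measurableSet_reach (n : ℕ) (w : List Bool) :
    MeasurableSet[sigmaOf U (beyond w)] (reach U n w) := by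
  induction n generalizing w with
  | zero => exact MeasurableSet.univ
  | succ n ih =>
    have hw (k : Fin 5) : (w, k) ∈ beyond w := List.suffix_refl w
    have hr (ε : Bool) : MeasurableSet[sigmaOf U (beyond w)] (reach U n (ε :: w)) :=
      sigmaOf_mono U (beyond_cons_subset ε w) _ (ih _)
    have ht := measurableSet_triangle U (hw 2) (hw 3) (hw 4)
    exact (measurableSet_crossing U (hw 0) (hw 1)).inter
      (((ht true).inter (hr true)).union ((ht false).inter (hr false)))

variable [MeasurableSpace Ω] {U} {μ : Measure Ω}

lemma sigmaOf_le (hU : ∀ i, MeasurableSet (U i)) (S : Set (List Bool × Fin 5)) :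
    sigmaOf U S ≤ ‹MeasurableSpace Ω› :=
  iSup₂_le fun i _ => MeasurableSpace.generateFrom_le (by rintro _ rfl; exact hU i)

lemma measureReal_inter_of_disjoint (hU : ∀ i, MeasurableSet (U i)) (hi : iIndepSet U μ)
    {S T : Set (List Bool × Fin 5)} (hST : Disjoint S T) {A B : Set Ω}
    (hA : MeasurableSet[sigmaOf U S] A) (hB : MeasurableSet[sigmaOf U T] B) :
    μ.real (A ∩ B) = μ.real A * μ.real B := by
  have h := (indep_iSup_of_disjoint
    (fun i => MeasurableSpace.generateFrom_le (by rintro _ rfl; exact hU i))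
    ((iIndepSet_iff_iIndep _ _).1 hi) hST)
  simp [measureReal_def, Indep_iff _ _ _ |>.1 h A B hA hB]

lemma measureReal_union_eq [IsFiniteMeasure μ] {s t : Set Ω} (ht : MeasurableSet t) :
    μ.real (s ∪ t) = μ.real s + μ.real t - μ.real (s ∩ t) := by
  linarith [measureReal_union_add_inter (μ := μ) (s := s) ht]

variable {p : ℝ}

lemma measureReal_inter_edges (hU : ∀ i, MeasurableSet (U i)) (hi : iIndepSet U μ)
    (hp : ∀ i, μ.real (U i) = p) {i j : List Bool × Fin 5} (hij : i ≠ j) :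
    μ.real (U i ∩ U j) = p ^ 2 := by
  rw [measureReal_inter_of_disjoint hU hi (Set.disjoint_singleton.2 hij)
    (measurableSet_sigmaOf U rfl) (measurableSet_sigmaOf U rfl), hp, hp, sq]

lemma measureReal_inter_edges₃ (hU : ∀ i, MeasurableSet (U i)) (hi : iIndepSet U μ)
    (hp : ∀ i, μ.real (U i) = p) {i j k : List Bool × Fin 5} (hij : i ≠ j) (hik : i ≠ k)
    (hjk : j ≠ k) : μ.real (U i ∩ (U j ∩ U k)) = p ^ 3 := by
  rw [measureReal_inter_of_disjoint hU hi (S := {i}) (T := {j, k}) (by simp [hij, hik])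
    (measurableSet_sigmaOf U rfl) (MeasurableSet.inter (m := sigmaOf U {j, k})
      (measurableSet_sigmaOf U (by simp)) (measurableSet_sigmaOf U (by simp))),
    measureReal_inter_edges hU hi hp hjk, hp]
  ring

variable [IsProbabilityMeasure μ]

lemma measureReal_union_edges (hU : ∀ i, MeasurableSet (U i)) (hi : iIndepSet U μ)
    (hp : ∀ i, μ.real (U i) = p) {i j : List Bool × Fin 5} (hij : i ≠ j) :
    μ.real (U i ∪ U j) = 2 * p - p ^ 2 := by
  rw [measureReal_union_eq (hU j), measureReal_inter_edges hU hi hp hij, hp, hp]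
  ring

lemma measureReal_triangle (hU : ∀ i, MeasurableSet (U i)) (hi : iIndepSet U μ)
    (hp : ∀ i, μ.real (U i) = p) (w : List Bool) (ε : Bool) :
    μ.real (triangle U w ε) = p + p ^ 2 - p ^ 3 := by
  cases ε
  all_goals
    rw [triangle, measureReal_union_eq ((hU _).inter (hU _)),
      measureReal_inter_edges hU hi hp (by simp), hp,
      measureReal_inter_edges₃ hU hi hp (by simp) (by simp) (by simp)]

lemma measureReal_triangle_inter (hU : ∀ i, MeasurableSet (U i)) (hi : iIndepSet U μ)
    (hp : ∀ i, μ.real (U i) = p) (w : List Bool) :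
    μ.real (triangle U w true ∩ triangle U w false) = 3 * p ^ 2 - 2 * p ^ 3 := by
  have h : triangle U w true ∩ triangle U w false =
      (U (w, 2) ∩ U (w, 4)) ∪ (U (w, 3) ∩ (U (w, 2) ∪ U (w, 4))) := by
    ext
    simp only [triangle, Set.mem_inter_iff, Set.mem_union]
    tauto
  have h' : (U (w, 2) ∩ U (w, 4)) ∩ (U (w, 3) ∩ (U (w, 2) ∪ U (w, 4))) =
      U (w, 2) ∩ (U (w, 4) ∩ U (w, 3)) := by
    ext
    simp only [Set.mem_inter_iff, Set.mem_union]
    tauto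
  rw [h, measureReal_union_eq ((hU _).inter ((hU _).union (hU _))), h',
    measureReal_inter_edges hU hi hp (by simp),
    measureReal_inter_edges₃ hU hi hp (by simp) (by simp) (by simp),
    measureReal_inter_of_disjoint hU hi (S := {(w, 3)}) (T := {(w, 2), (w, 4)}) (by simp)
      (measurableSet_sigmaOf U rfl) (MeasurableSet.union (m := sigmaOf U {(w, 2), (w, 4)})
      (measurableSet_sigmaOf U (by simp)) (measurableSet_sigmaOf U (by simp))),
    measureReal_union_edges hU hi hp (by simp), hp]
  ring

/-- The probability of surviving for `n` generations. -/
def survival (p : ℝ) : ℕ → ℝ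
  | 0 => 1
  | n + 1 => offspringMean p * survival p n - offspringBoth p * survival p n ^ 2

lemma not_cons_suffix_self (ε : Bool) (w : List Bool) : ¬ ε :: w <:+ w := fun h => by
  simpa using h.length_le

lemma disjoint_beyond_cons (w : List Bool) :
    Disjoint (beyond (true :: w)) (beyond (false :: w)) := by
  rw [Set.disjoint_left]
  intro i h₁ h₂
  have := (List.suffix_of_suffix_length_le h₁ h₂ (by simp)).eq_of_length (by simp)
  simp at this

lemma measureReal_reach (hU : ∀ i, MeasurableSet (U i)) (hi : iIndepSet U μ)
    (hp : ∀ i, μ.real (U i) = p) (n : ℕ) (w : List Bool) :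
    μ.real (reach U n w) = survival p n := by
  induction n generalizing w with
  | zero => simp [reach, survival]
  | succ n ih =>
    let T : Set (List Bool × Fin 5) := {(w, 2), (w, 3), (w, 4)}
    let B (ε : Bool) := beyond (ε :: w)
    have hT := measurableSet_triangle U (w := w) (S := T) (by simp [T]) (by simp [T]) (by simp [T])
    have hR (ε : Bool) : MeasurableSet[sigmaOf U (B ε)] (reach U n (ε :: w)) :=
      measurableSet_reach U n _
    have hTB (ε : Bool) : Disjoint T (B ε) := by
      simp [T, B, beyond, not_cons_suffix_self]
    have hB (ε : Bool) : B ε ⊆ T ∪ (B true ∪ B false) := by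
      cases ε
      · exact fun x hx => .inr (.inr hx)
      · exact fun x hx => .inr (.inl hx)
    have hTR (ε : Bool) : MeasurableSet[sigmaOf U (T ∪ (B true ∪ B false))]
        (triangle U w ε ∩ reach U n (ε :: w)) :=
      MeasurableSet.inter (m := sigmaOf U (T ∪ (B true ∪ B false)))
        (sigmaOf_mono U Set.subset_union_left _ (hT ε)) (sigmaOf_mono U (hB ε) _ (hR ε))
    have hBB := sigmaOf_mono U (Set.subset_union_left (s := B true) (t := B false))
    have hBB' := sigmaOf_mono U (Set.subset_union_right (s := B true) (t := B false))
    have hdisj :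
        Disjoint ({(w, 0), (w, 1)} : Set (List Bool × Fin 5)) (T ∪ (B true ∪ B false)) := by
      simp [T, B, beyond, not_cons_suffix_self]
    rw [reach, measureReal_inter_of_disjoint hU hi hdisj
        (measurableSet_crossing U (by simp) (by simp))
        (MeasurableSet.union (m := sigmaOf U (T ∪ (B true ∪ B false))) (hTR true) (hTR false)),
      measureReal_union_eq (sigmaOf_le hU _ _ (hTR false)), Set.inter_inter_inter_comm,
      measureReal_inter_of_disjoint hU hi (hTB true) (hT true) (hR true),
      measureReal_inter_of_disjoint hU hi (hTB false) (hT false) (hR false),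
      measureReal_inter_of_disjoint hU hi
        (Set.disjoint_union_right.2 ⟨hTB true, hTB false⟩)
        (MeasurableSet.inter (m := sigmaOf U T) (hT true) (hT false))
        (MeasurableSet.inter (m := sigmaOf U (B true ∪ B false))
          (hBB _ (hR true)) (hBB' _ (hR false))),
      measureReal_inter_of_disjoint hU hi (disjoint_beyond_cons w) (hR true) (hR false),
      crossing, measureReal_union_edges hU hi hp (by simp),
      measureReal_triangle hU hi hp, measureReal_triangle hU hi hp,
      measureReal_triangle_inter hU hi hp, ih, ih, survival, offspringMean, offspringBoth]
    ring

lemma survival_le_pow (hp : p ∈ Set.Icc (0 : ℝ) 1) (n : ℕ) :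
    survival p n ≤ offspringMean p ^ n := by
  obtain ⟨hp0, hp1⟩ := hp
  have hα : 0 ≤ 2 * p - p ^ 2 := by nlinarith
  have hm : 0 ≤ offspringMean p := by
    have : 0 ≤ p + p ^ 2 - p ^ 3 := by nlinarith [mul_nonneg (sq_nonneg p) (sub_nonneg.2 hp1)]
    unfold offspringMean
    positivity
  have hκ : 0 ≤ offspringBoth p := by
    have : 0 ≤ 3 * p ^ 2 - 2 * p ^ 3 := by nlinarith [mul_nonneg (sq_nonneg p) (sub_nonneg.2 hp1)]
    unfold offspringBoth
    positivity
  induction n with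
  | zero => simp [survival]
  | succ n ih =>
    rw [survival, pow_succ' (offspringMean p)]
    nlinarith [mul_le_mul_of_nonneg_left ih hm, mul_nonneg hκ (sq_nonneg (survival p n))]

lemma exists_pos_le_survival (hp : p ∈ Set.Ioc (0 : ℝ) 1) (hm : 1 < offspringMean p)
    (h1 : ∀ n, survival p n ≤ 1) : ∃ c > 0, ∀ n, c ≤ survival p n := by
  obtain ⟨hp0, hp1⟩ := hp
  have hα : 0 < 2 * p - p ^ 2 := by nlinarith
  have hκ : 0 < offspringBoth p := by
    have : 0 < 3 * p ^ 2 - 2 * p ^ 3 := by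
      nlinarith [mul_nonneg (sq_nonneg p) (sub_nonneg.2 hp1), pow_pos hp0 2]
    unfold offspringBoth
    positivity
  have h₁ : offspringMean p - offspringBoth p ≤ 1 := by
    have : offspringMean p - offspringBoth p = (2 * p - p ^ 2) ^ 2 := by
      unfold offspringMean offspringBoth
      ring
    rw [this]
    exact pow_le_one₀ hα.le (by nlinarith [sq_nonneg (1 - p)])
  have h₂ : 2 * offspringBoth p ≤ offspringMean p := by
    have : offspringMean p - 2 * offspringBoth p = 2 * (2 * p - p ^ 2) * (p * (1 - p) ^ 2) := by
      unfold offspringMean offspringBoth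
      ring
    have : 0 ≤ offspringMean p - 2 * offspringBoth p := by rw [this]; positivity
    linarith
  obtain ⟨c, hc⟩ : ∃ c, offspringBoth p * c = offspringMean p - 1 :=
    ⟨(offspringMean p - 1) / offspringBoth p, by field_simp⟩
  have hc0 : 0 < c := by
    by_contra! h
    nlinarith
  have hc1 : c ≤ 1 := by
    by_contra! h
    nlinarith
  refine ⟨c, hc0, fun n => ?_⟩
  induction n with
  | zero => exact hc1
  | succ n ih =>
    have h : survival p (n + 1) - c = (survival p n - c) *
        (offspringMean p - offspringBoth p * (survival p n + c)) := by
      rw [survival]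
      linear_combination -c * hc
    have : 0 ≤ survival p (n + 1) - c := by
      rw [h]
      refine mul_nonneg (by linarith) ?_
      nlinarith [h1 n]
    linarith

end Reach

section Branch

variable {G ι : Type*} [Group G] (f : ι → G) (i j : ι)

/-- The vertices of the branch rooted at `g`, indexed by the binary tree: each `ε` stands for
the word `ab` or `ab⁻¹`, where `a = f i` and `b = f j`. -/
def branch (g : G) : List Bool → G
  | [] => g
  | ε :: w => branch g w * f i * bif ε then f j else (f j)⁻¹

lemma branch_eq_mul (g : G) (w : List Bool) : branch f i j g w = g * branch f i j 1 w := by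
  induction w with
  | nil => simp [branch]
  | cons ε w ih => rw [branch, branch, ih]; group

/-- The two parallel `a`-edges leaving a node of the branch and the three edges of the
`b`-triangle they lead to. -/
def branchEdge (g : G) : List Bool × Fin 5 → G × ι
  | (w, 0) => (branch f i j g w, i)
  | (w, 1) => (branch f i j g w * f i, i)
  | (w, 2) => (branch f i j g w * f i, j)
  | (w, 3) => (branch f i j g w * f i * f j, j)
  | (w, 4) => (branch f i j g w * f i * (f j)⁻¹, j)

/-- The event that the edge of the branch with a given index is open. -/
def branchOpen (g : G) (k : List Bool × Fin 5) : Set (Config (G × ι)) :=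
  {ω | ω (branchEdge f i j g k) = true}

/-- The nodes of the branch and their `a`-neighbours are pairwise distinct. -/
def FreeBranch : Prop :=
  Function.Injective fun x : List Bool × Bool => branch f i j 1 x.1 * bif x.2 then f i else 1

variable {f i j}

lemma FreeBranch.branch_injective (h : FreeBranch f i j) (g : G) :
    Function.Injective (branch f i j g) := fun v w hvw => by
  rw [branch_eq_mul, branch_eq_mul f i j g w] at hvw
  simpa using @h (v, false) (w, false) (by simpa using hvw)

lemma FreeBranch.branch_ne (h : FreeBranch f i j) (g : G) (v w : List Bool) :
    branch f i j g v ≠ branch f i j g w * f i := fun hvw => by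
  rw [branch_eq_mul, branch_eq_mul f i j g w, mul_assoc] at hvw
  simpa using @h (v, false) (w, true) (by simpa using hvw)

lemma FreeBranch.branchEdge_injective (h : FreeBranch f i j) (hij : i ≠ j) (g : G) :
    Function.Injective (branchEdge f i j g) := by
  have hinj := h.branch_injective g
  have hne := h.branch_ne g
  have hne' (v w : List Bool) := (hne v w).symm
  have htt (w : List Bool) : branch f i j g w * f i * f j = branch f i j g (true :: w) := rfl
  have hff (w : List Bool) : branch f i j g w * f i * (f j)⁻¹ = branch f i j g (false :: w) := rfl
  rintro ⟨v, k⟩ ⟨w, l⟩ hvw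
  fin_cases k <;> fin_cases l <;>
    simp [branchEdge, hij, hij.symm, htt, hff, hinj.eq_iff, hne, hne'] at hvw ⊢ <;> exact hvw

end Branch

section Cluster

variable {G ι : Type*} [Group G] {f : ι → G} {i j : ι}

lemma conn_of_open {ω : Config (G × ι)} {x : G} {k : ι} (h : ω (x, k) = true) :
    Conn f ω x (x * f k) :=
  .single ⟨k, .inl ⟨h, rfl⟩⟩

lemma conn_of_open' {ω : Config (G × ι)} {x : G} {k : ι} (h : ω (x, k) = true) :
    Conn f ω (x * f k) x :=
  .single ⟨k, .inr ⟨h, rfl⟩⟩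

lemma conn_of_mem_crossing (ha : f i * f i = 1) {g : G} {w : List Bool} {ω : Config (G × ι)}
    (h : ω ∈ crossing (branchOpen f i j g) w) :
    Conn f ω (branch f i j g w) (branch f i j g w * f i) := by
  rcases h with h | h
  · exact conn_of_open h
  · simpa [mul_assoc, ha] using conn_of_open' (f := f) h

lemma conn_of_mem_triangle (hb : f j * f j = (f j)⁻¹) {g : G} {w : List Bool} {ε : Bool}
    {ω : Config (G × ι)} (h : ω ∈ triangle (branchOpen f i j g) w ε) :
    Conn f ω (branch f i j g w * f i) (branch f i j g (ε :: w)) := by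
  have h₃ (h : ω ∈ branchOpen f i j g (w, 3)) :
      Conn f ω (branch f i j g w * f i * f j) (branch f i j g w * f i * (f j)⁻¹) ∧
      Conn f ω (branch f i j g w * f i * (f j)⁻¹) (branch f i j g w * f i * f j) := by
    have h₁ := conn_of_open (f := f) h
    have h₂ := conn_of_open' (f := f) h
    rw [mul_assoc _ (f j) (f j), hb] at h₁ h₂
    exact ⟨h₁, h₂⟩
  have h₄ (h : ω ∈ branchOpen f i j g (w, 4)) :
      Conn f ω (branch f i j g w * f i) (branch f i j g w * f i * (f j)⁻¹) := by
    simpa using conn_of_open' (f := f) h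
  cases ε
  · rcases h with h | ⟨h, h'⟩
    · exact h₄ h
    · exact (conn_of_open h).trans (h₃ h').1
  · rcases h with h | ⟨h, h'⟩
    · exact conn_of_open h
    · exact (h₄ h).trans (h₃ h').2

lemma exists_conn_of_mem_reach (ha : f i * f i = 1) (hb : f j * f j = (f j)⁻¹) {g : G}
    {ω : Config (G × ι)} {n : ℕ} {w : List Bool} (h : ω ∈ reach (branchOpen f i j g) n w) :
    ∃ v : List Bool, v.length = w.length + n ∧
      Conn f ω (branch f i j g w) (branch f i j g v) := by
  induction n generalizing w with
  | zero => exact ⟨w, rfl, .refl⟩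
  | succ n ih =>
    obtain ⟨hc, h⟩ := h
    have hε : ∃ ε, ω ∈ triangle (branchOpen f i j g) w ε ∩
        reach (branchOpen f i j g) n (ε :: w) := by
      rcases h with h | h
      exacts [⟨_, h⟩, ⟨_, h⟩]
    obtain ⟨ε, ht, hr⟩ := hε
    obtain ⟨v, hv, hconn⟩ := ih hr
    refine ⟨v, by simp only [hv, List.length_cons]; omega, ?_⟩
    exact ((conn_of_mem_crossing ha hc).trans (conn_of_mem_triangle hb ht)).trans hconn

lemma cluster_infinite_of_forall_mem_reach (ha : f i * f i = 1) (hb : f j * f j = (f j)⁻¹)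
    (hfree : FreeBranch f i j) {ω : Config (G × ι)}
    (h : ∀ n, ω ∈ reach (branchOpen f i j 1) n []) : (cluster f ω).Infinite := by
  choose v hv hconn using fun n => exists_conn_of_mem_reach ha hb (h n)
  refine Set.infinite_of_injective_forall_mem (f := fun n => branch f i j 1 (v n)) ?_ hconn
  intro m n hmn
  simpa [hv] using congrArg List.length (hfree.branch_injective 1 hmn)

lemma step_cases (hij : ∀ k, k = i ∨ k = j) (ha : f i * f i = 1) {ω : Config (G × ι)} {x y : G}
    (h : Step f ω x y) :
    (y = x * f i ∧ (ω (x, i) = true ∨ ω (x * f i, i) = true)) ∨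
      (y = x * f j ∧ ω (x, j) = true) ∨ (y = x * (f j)⁻¹ ∧ ω (x * (f j)⁻¹, j) = true) := by
  obtain ⟨k, h⟩ := h
  rcases hij k with rfl | rfl <;> rcases h with ⟨h, rfl⟩ | ⟨h, rfl⟩
  · exact .inl ⟨rfl, .inl h⟩
  · exact .inl ⟨by rw [mul_assoc, ha, mul_one], .inr (by rwa [mul_assoc, ha, mul_one])⟩
  · exact .inr (.inl ⟨rfl, h⟩)
  · exact .inr (.inr ⟨by simp, by simpa⟩)

/-- Open steps starting in `F` can leave `F` only from `r`, along a `b`-edge. -/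
def ClosedExceptAt (f : ι → G) (j : ι) (ω : Config (G × ι)) (r : G) (F : Set G) : Prop :=
  ∀ x ∈ F, ∀ y, Step f ω x y → y ∈ F ∨
    (x = r ∧ ((y = r * f j ∧ ω (r, j) = true) ∨ (y = r * (f j)⁻¹ ∧ ω (r * (f j)⁻¹, j) = true)))

lemma exists_finite_of_notMem_reach (hij : ∀ k, k = i ∨ k = j) (ha : f i * f i = 1)
    (hb : f j * f j = (f j)⁻¹) {g : G} {ω : Config (G × ι)} {n : ℕ} {w : List Bool}
    (h : ω ∉ reach (branchOpen f i j g) n w) :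
    ∃ F : Set G, F.Finite ∧ branch f i j g w ∈ F ∧
      ClosedExceptAt f j ω (branch f i j g w) F := by
  have hb' : (f j)⁻¹ * (f j)⁻¹ = f j := by
    rw [← mul_inv_rev, hb, inv_inv]
  induction n generalizing w with
  | zero => exact absurd (Set.mem_univ ω) h
  | succ n ih =>
    set r := branch f i j g w with hr
    by_cases hc : ω ∈ crossing (branchOpen f i j g) w
    · have hF (ε : Bool) : ∃ F : Set G, F.Finite ∧
          (ω ∈ triangle (branchOpen f i j g) w ε → branch f i j g (ε :: w) ∈ F) ∧
          (F.Nonempty → ω ∈ triangle (branchOpen f i j g) w ε) ∧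
          ClosedExceptAt f j ω (branch f i j g (ε :: w)) F := by
        by_cases ht : ω ∈ triangle (branchOpen f i j g) w ε
        · obtain ⟨F, hF⟩ := ih (w := ε :: w) fun hr => h ⟨hc, by
            cases ε
            exacts [.inr ⟨ht, hr⟩, .inl ⟨ht, hr⟩]⟩
          exact ⟨F, hF.1, fun _ => hF.2.1, fun _ => ht, hF.2.2⟩
        · exact ⟨∅, Set.finite_empty, fun h => absurd h ht, by simp, by simp [ClosedExceptAt]⟩
      choose F hfin hmem htri hcl using hF
      have h₂ (h : ω (r * f i, j) = true) : r * f i * f j ∈ F true := hmem true (.inl h)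
      have h₄ (h : ω (r * f i * (f j)⁻¹, j) = true) : r * f i * (f j)⁻¹ ∈ F false :=
        hmem false (.inl h)
      refine ⟨{r, r * f i} ∪ (F true ∪ F false),
        (Set.toFinite _).union ((hfin _).union (hfin _)), by simp, ?_⟩
      rintro x ((rfl | rfl) | hx | hx) y hs
      · rcases step_cases hij ha hs with ⟨rfl, -⟩ | hs
        · simp
        · exact .inr ⟨rfl, hs⟩
      · rcases step_cases hij ha hs with ⟨rfl, -⟩ | ⟨rfl, ho⟩ | ⟨rfl, ho⟩
        · simp [mul_assoc, ha]
        · exact .inl (.inr (.inl (h₂ ho)))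
        · exact .inl (.inr (.inr (h₄ ho)))
      · rcases hcl true x hx y hs with hy | ⟨rfl, ⟨rfl, ho⟩ | ⟨rfl, ho⟩⟩
        · exact .inl (.inr (.inl hy))
        · have : branch f i j g (true :: w) * f j = branch f i j g (false :: w) := by
            simp [branch, mul_assoc, hb]
          rw [this]
          refine .inl (.inr (.inr (hmem false ?_)))
          rcases htri true ⟨_, hx⟩ with h | h
          · exact .inr ⟨h, ho⟩
          · exact .inl h.1
        · simp [branch, hr]
      · rcases hcl false x hx y hs with hy | ⟨rfl, ⟨rfl, ho⟩ | ⟨rfl, ho⟩⟩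
        · exact .inl (.inr (.inr hy))
        · simp [branch, hr]
        · have : branch f i j g (false :: w) * (f j)⁻¹ = branch f i j g (true :: w) := by
            simp [branch, mul_assoc, hb']
          rw [this] at ho ⊢
          refine .inl (.inr (.inl (hmem true ?_)))
          rcases htri false ⟨_, hx⟩ with h | h
          · exact .inr ⟨h, ho⟩
          · exact .inl h.1
    · refine ⟨{r}, Set.finite_singleton r, rfl, ?_⟩
      rintro x rfl y hs
      rcases step_cases hij ha hs with ⟨-, hs⟩ | hs
      · exact absurd hs hc
      · exact .inr ⟨rfl, hs⟩

lemma mem_reach_of_cluster_infinite (hij : ∀ k, k = i ∨ k = j) (ha : f i * f i = 1)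
    (hb : f j * f j = (f j)⁻¹) {ω : Config (G × ι)} (h : (cluster f ω).Infinite) (n : ℕ) :
    ∃ g ∈ ({1, f j, (f j)⁻¹} : Set G), ω ∈ reach (branchOpen f i j g) n [] := by
  by_contra! hg
  have hb' : (f j)⁻¹ * (f j)⁻¹ = f j := by
    rw [← mul_inv_rev, hb, inv_inv]
  obtain ⟨F₁, hfin₁, hmem₁, hcl₁⟩ := exists_finite_of_notMem_reach hij ha hb (hg 1 (by simp))
  obtain ⟨F₂, hfin₂, hmem₂, hcl₂⟩ := exists_finite_of_notMem_reach hij ha hb (hg (f j) (by simp))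
  obtain ⟨F₃, hfin₃, hmem₃, hcl₃⟩ :=
    exists_finite_of_notMem_reach hij ha hb (hg (f j)⁻¹ (by simp))
  simp only [branch] at hmem₁ hmem₂ hmem₃ hcl₁ hcl₂ hcl₃
  refine h (((hfin₁.union hfin₂).union hfin₃).subset fun x hx => ?_)
  induction hx with
  | refl => exact .inl (.inl hmem₁)
  | tail _ hs ih =>
    rcases ih with (ih | ih) | ih
    · rcases hcl₁ _ ih _ hs with h | ⟨-, ⟨rfl, -⟩ | ⟨rfl, -⟩⟩
      · exact .inl (.inl h)
      · simp [hmem₂]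
      · simp [hmem₃]
    · rcases hcl₂ _ ih _ hs with h | ⟨-, ⟨rfl, -⟩ | ⟨rfl, -⟩⟩
      · exact .inl (.inr h)
      · simp [hb, hmem₃]
      · simp [hmem₁]
    · rcases hcl₃ _ ih _ hs with h | ⟨-, ⟨rfl, -⟩ | ⟨rfl, -⟩⟩
      · exact .inr h
      · simp [hmem₁]
      · simp [hb', hmem₂]

end Cluster

section Threshold

variable {G ι : Type*} [Group G] {f : ι → G} {i j : ι} {p : ℝ} {μ : Measure (Config (G × ι))}

lemma IsBernoulli.isProbabilityMeasure {E : Type*} {μ : Measure (Config E)}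
    (h : IsBernoulli p μ) : IsProbabilityMeasure μ :=
  ⟨by simpa using h ∅ fun _ => true⟩

lemma IsBernoulli.measure_open {E : Type*} {μ : Measure (Config E)} (h : IsBernoulli p μ) (e : E) :
    μ {ω | ω e = true} = ENNReal.ofReal p := by
  simpa using h {e} fun _ => true

lemma measurableSet_open {E : Type*} (e : E) : MeasurableSet {ω : Config E | ω e = true} :=
  (measurable_pi_apply (X := fun _ => Bool) e) (measurableSet_singleton true)

lemma IsBernoulli.iIndepSet_open {E : Type*} {μ : Measure (Config E)} (h : IsBernoulli p μ) :
    iIndepSet (fun e => {ω : Config E | ω e = true}) μ := by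
  have := h.isProbabilityMeasure
  rw [iIndepSet_iff_meas_biInter measurableSet_open]
  intro s
  simp only [h.measure_open]
  have hs : ⋂ e ∈ s, {ω : Config E | ω e = true} = {ω | ∀ e ∈ s, ω e = true} := by
    ext
    simp
  simpa [hs] using h s fun _ => true

lemma IsBernoulli.measureReal_reach (h : IsBernoulli p μ) (hp : p ∈ Set.Icc (0 : ℝ) 1)
    (hij : i ≠ j) (hfree : FreeBranch f i j) (g : G) (n : ℕ) :
    μ.real (reach (branchOpen f i j g) n []) = survival p n := by
  have := h.isProbabilityMeasure
  refine Perc.measureReal_reach (fun _ => measurableSet_open _)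
    (h.iIndepSet_open.precomp (hfree.branchEdge_injective hij g)) (fun k => ?_) n []
  exact (congrArg ENNReal.toReal (h.measure_open _)).trans (ENNReal.toReal_ofReal hp.1)

lemma theta_eq_zero (h : IsBernoulli p μ) (hp : p ∈ Set.Icc (0 : ℝ) 1)
    (hij : i ≠ j) (hij' : ∀ k, k = i ∨ k = j) (ha : f i * f i = 1) (hb : f j * f j = (f j)⁻¹)
    (hfree : FreeBranch f i j) (hm : offspringMean p < 1) (hm0 : 0 ≤ offspringMean p) :
    theta f μ = 0 := by
  have := h.isProbabilityMeasure
  have hle (n : ℕ) : theta f μ ≤ 3 * offspringMean p ^ n := by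
    classical
    let s : Finset G := {1, f j, (f j)⁻¹}
    have hsub : {ω : Config (G × ι) | (cluster f ω).Infinite} ⊆
        ⋃ g ∈ s, reach (branchOpen f i j g) n [] := fun ω hω => by
      
      simpa [s] using mem_reach_of_cluster_infinite hij' ha hb hω n
    calc theta f μ ≤ μ.real (⋃ g ∈ s, reach (branchOpen f i j g) n []) :=
          measureReal_mono hsub (measure_ne_top _ _)
      _ ≤ ∑ g ∈ s, μ.real (reach (branchOpen f i j g) n []) := measureReal_biUnion_finset_le _ _
      _ = s.card * survival p n := by simp [h.measureReal_reach hp hij hfree]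
      _ ≤ 3 * offspringMean p ^ n := by
        have h₀ : 0 ≤ survival p n := h.measureReal_reach hp hij hfree 1 n ▸ measureReal_nonneg
        exact mul_le_mul (by exact_mod_cast Finset.card_le_three) (survival_le_pow hp n) h₀
          (by norm_num)
  have hlim : Tendsto (fun n => 3 * offspringMean p ^ n) atTop (𝓝 (3 * 0)) :=
    (tendsto_pow_atTop_nhds_zero_of_lt_one hm0 hm).const_mul 3
  rw [mul_zero] at hlim
  exact le_antisymm (ge_of_tendsto' hlim hle) ENNReal.toReal_nonneg

lemma theta_pos (h : IsBernoulli p μ) (hp : p ∈ Set.Ioc (0 : ℝ) 1) (hij : i ≠ j)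
    (ha : f i * f i = 1) (hb : f j * f j = (f j)⁻¹) (hfree : FreeBranch f i j)
    (hm : 1 < offspringMean p) : 0 < theta f μ := by
  have := h.isProbabilityMeasure
  have hreach := h.measureReal_reach ⟨hp.1.le, hp.2⟩ hij hfree 1
  obtain ⟨c, hc, hcn⟩ := exists_pos_le_survival hp hm fun n => hreach n ▸ measureReal_le_one
  have hmeas (n : ℕ) : MeasurableSet (reach (branchOpen f i j 1) n []) :=
    sigmaOf_le (fun _ => measurableSet_open _) _ _ (measurableSet_reach _ n [])
  have hlim := tendsto_measure_iInter_atTop (μ := μ) (fun n => (hmeas n).nullMeasurableSet)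
    (reach_antitone (branchOpen f i j 1) []) ⟨0, measure_ne_top _ _⟩
  have hlim' := (ENNReal.tendsto_toReal (measure_ne_top μ _)).comp hlim
  have hle : c ≤ μ.real (⋂ n, reach (branchOpen f i j 1) n []) :=
    ge_of_tendsto' hlim' fun n => (hcn n).trans_eq (hreach n).symm
  exact hc.trans_le (hle.trans (measureReal_mono fun ω hω =>
    cluster_infinite_of_forall_mem_reach ha hb hfree (Set.mem_iInter.1 hω)))

lemma pc_eq_of_offspringMean_eq_one {μ : ℝ → Measure (Config (G × ι))}
    (hμ : ∀ p ∈ Set.Icc (0 : ℝ) 1, IsBernoulli p (μ p))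
    (hij : i ≠ j) (hij' : ∀ k, k = i ∨ k = j) (ha : f i * f i = 1) (hb : f j * f j = (f j)⁻¹)
    (hfree : FreeBranch f i j) {r : ℝ} (hr : r ∈ Set.Ioo (0 : ℝ) 1) (hm : offspringMean r = 1) :
    pc f μ = r := by
  have hr' : r ∈ Set.Icc (0 : ℝ) 1 := Set.Ioo_subset_Icc_self hr
  refine csInf_eq_of_forall_ge_of_forall_gt_exists_lt ⟨1, by simp⟩ ?_ ?_
  · rintro p (⟨hp, hθ⟩ | rfl)
    · by_contra! hlt
      have h0 := offspringMean_strictMonoOn.monotoneOn ⟨le_rfl, zero_le_one⟩ hp hp.1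
      have h1 := offspringMean_strictMonoOn hp hr' hlt
      refine hθ.ne' (theta_eq_zero (hμ p hp) hp hij hij' ha hb hfree (hm ▸ h1) ?_)
      simpa [offspringMean] using h0
    · exact hr.2.le
  · intro q hq
    obtain ⟨p, hrp, hpq⟩ := exists_between (lt_min hq hr.2)
    have hp : p ∈ Set.Ioc (0 : ℝ) 1 := ⟨hr.1.trans hrp, (hpq.trans_le (min_le_right _ _)).le⟩
    have hp' := Set.Ioc_subset_Icc_self hp
    exact ⟨p, .inl ⟨hp', theta_pos (hμ p hp') hp hij ha hb hfree
      (hm ▸ offspringMean_strictMonoOn hr' hp' hrp)⟩, hpq.trans_le (min_le_left _ _)⟩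

end Threshold

section Modular

/-- The homomorphism from a finite cyclic group sending the generator to `x`. -/
def zmodPowHom {H : Type*} [Group H] (n : ℕ) [NeZero n] (x : H) (hx : x ^ n = 1) :
    Multiplicative (ZMod n) →* H :=
  MonoidHom.mk' (fun k => x ^ k.toAdd.val) fun k l => by
    rw [toAdd_mul, ZMod.val_add, ← pow_add, ← pow_eq_pow_mod _ hx]

/-- Right multiplication by the generator of order two, acting on the cosets of the factor of
order three. -/
def permA : Equiv.Perm (List Bool × Bool) :=
  (Equiv.refl _).prodCongr Equiv.boolNot

/-- Right multiplication by the generator of order three, acting on the cosets of the factor of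
order three. -/
def permB : Equiv.Perm (List Bool × Bool) where
  toFun
    | (w, true) => (true :: w, false)
    | (true :: w, false) => (false :: w, false)
    | (false :: w, false) => (w, true)
    | ([], false) => ([], false)
  invFun
    | (w, true) => (false :: w, false)
    | (true :: w, false) => (w, true)
    | (false :: w, false) => (true :: w, false)
    | ([], false) => ([], false)
  left_inv := by rintro ⟨_ | ⟨_ | _, _⟩, _ | _⟩ <;> rfl
  right_inv := by rintro ⟨_ | ⟨_ | _, _⟩, _ | _⟩ <;> rfl

lemma permA_sq : permA ^ 2 = 1 := by
  ext1 ⟨w, δ⟩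
  cases δ <;> rfl

lemma permB_cube : permB ^ 3 = 1 := by
  ext1 x
  obtain ⟨_ | ⟨_ | _, _⟩, _ | _⟩ := x <;> rfl

/-- The right action of `C₂ * C₃` on the cosets of `C₃`. -/
def cosetAction : Monoid.Coprod (Multiplicative (ZMod 2)) (Multiplicative (ZMod 3)) →*
    (Equiv.Perm (List Bool × Bool))ᵐᵒᵖ :=
  Monoid.Coprod.lift
    (zmodPowHom 2 (.op permA) (by rw [← MulOpposite.op_pow, permA_sq, MulOpposite.op_one]))
    (zmodPowHom 3 (.op permB) (by rw [← MulOpposite.op_pow, permB_cube, MulOpposite.op_one]))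

/-- The standard generators of `C₂ * C₃`. -/
abbrev modularGens :=
  coprodGens ({Multiplicative.ofAdd (1 : ZMod 2)} : Set (Multiplicative (ZMod 2)))
    ({Multiplicative.ofAdd (1 : ZMod 3)} : Set (Multiplicative (ZMod 3)))

lemma cosetAction_inl (s) : cosetAction (modularGens (.inl s)) = .op permA := by
  obtain ⟨_, rfl⟩ := s
  exact pow_one _

lemma cosetAction_inr (s) : cosetAction (modularGens (.inr s)) = .op permB := by
  obtain ⟨_, rfl⟩ := s
  exact pow_one _

lemma freeBranch_modularGens (s t) : FreeBranch modularGens (.inl s) (.inr t) := by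
  have key (w : List Bool) :
      (cosetAction (branch modularGens (.inl s) (.inr t) 1 w)).unop ([], false) = (w, false) := by
    induction w with
    | nil => simp [branch]
    | cons ε w ih =>
      cases ε
      · simp only [branch, map_mul, cond_false, map_inv, cosetAction_inl, cosetAction_inr,
          MulOpposite.unop_mul, MulOpposite.unop_inv, MulOpposite.unop_op, Equiv.Perm.mul_apply, ih]
        rfl
      · simp only [branch, map_mul, cond_true, cosetAction_inl, cosetAction_inr,
          MulOpposite.unop_mul, MulOpposite.unop_op, Equiv.Perm.mul_apply, ih]
        rfl
  refine Function.LeftInverse.injective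
    (g := fun x => (cosetAction x).unop ([], false)) fun ⟨w, δ⟩ => ?_
  cases δ
  · simp [key]
  · simp only [cond_true, map_mul, cosetAction_inl, MulOpposite.unop_mul, MulOpposite.unop_op,
      Equiv.Perm.mul_apply, key]
    rfl

lemma modularGens_inl_mul_self (s) : modularGens (.inl s) * modularGens (.inl s) = 1 := by
  obtain ⟨_, rfl⟩ := s
  change Monoid.Coprod.inl _ * Monoid.Coprod.inl _ = 1
  rw [← map_mul, ← map_one Monoid.Coprod.inl]
  rfl

lemma modularGens_inr_mul_self (s) :
    modularGens (.inr s) * modularGens (.inr s) = (modularGens (.inr s))⁻¹ := by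
  obtain ⟨_, rfl⟩ := s
  change Monoid.Coprod.inr _ * Monoid.Coprod.inr _ = (Monoid.Coprod.inr _)⁻¹
  rw [← map_mul, ← map_inv]
  rfl

end Modular

end Perc

open Perc

/-- The polynomial `2x⁵ - 6x⁴ + 2x³ + 4x² - 1` has exactly one root
in `(0,1)`, and the critical probability of the Cayley graph of
`C₂ * C₃ ≅ PSL₂(ℤ)` (with the standard generators `a` of `C₂` and `b` of `C₃`)
equals this root. -/
theorem pc_modular_group
    (μ : ℝ → Measure (Config (Monoid.Coprod (Multiplicative (ZMod 2)) (Multiplicative (ZMod 3)) ×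
      (({Multiplicative.ofAdd (1 : ZMod 2)} : Set (Multiplicative (ZMod 2))) ⊕
       ({Multiplicative.ofAdd (1 : ZMod 3)} : Set (Multiplicative (ZMod 3)))))))
    (hμ : ∀ p ∈ Set.Icc (0 : ℝ) 1, IsBernoulli p (μ p)) :
    (∃! x : ℝ, x ∈ Set.Ioo (0 : ℝ) 1 ∧
      2 * x ^ 5 - 6 * x ^ 4 + 2 * x ^ 3 + 4 * x ^ 2 - 1 = 0) ∧
    pc (coprodGens ({Multiplicative.ofAdd (1 : ZMod 2)} : Set (Multiplicative (ZMod 2)))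
        ({Multiplicative.ofAdd (1 : ZMod 3)} : Set (Multiplicative (ZMod 3)))) μ
      ∈ Set.Ioo (0 : ℝ) 1 ∧
    2 * (pc (coprodGens ({Multiplicative.ofAdd (1 : ZMod 2)} : Set (Multiplicative (ZMod 2)))
        ({Multiplicative.ofAdd (1 : ZMod 3)} : Set (Multiplicative (ZMod 3)))) μ) ^ 5
      - 6 * (pc (coprodGens ({Multiplicative.ofAdd (1 : ZMod 2)} : Set (Multiplicative (ZMod 2)))
        ({Multiplicative.ofAdd (1 : ZMod 3)} : Set (Multiplicative (ZMod 3)))) μ) ^ 4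
      + 2 * (pc (coprodGens ({Multiplicative.ofAdd (1 : ZMod 2)} : Set (Multiplicative (ZMod 2)))
        ({Multiplicative.ofAdd (1 : ZMod 3)} : Set (Multiplicative (ZMod 3)))) μ) ^ 3
      + 4 * (pc (coprodGens ({Multiplicative.ofAdd (1 : ZMod 2)} : Set (Multiplicative (ZMod 2)))
        ({Multiplicative.ofAdd (1 : ZMod 3)} : Set (Multiplicative (ZMod 3)))) μ) ^ 2
      - 1 = 0 := by
  obtain ⟨r, hr, hm⟩ := exists_offspringMean_eq_one
  have hpc := pc_eq_of_offspringMean_eq_one hμ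
    (i := .inl ⟨_, rfl⟩) (j := .inr ⟨_, rfl⟩) Sum.inl_ne_inr
    (by rintro (⟨_, rfl⟩ | ⟨_, rfl⟩) <;> simp) (modularGens_inl_mul_self _)
    (modularGens_inr_mul_self _) (freeBranch_modularGens _ _) hr hm
  refine ⟨⟨r, ⟨hr, (offspringMean_eq_one_iff r).1 hm⟩, fun x ⟨hx, hx'⟩ => ?_⟩, ?_, ?_⟩
  · exact offspringMean_strictMonoOn.injOn (Set.Ioo_subset_Icc_self hx)
      (Set.Ioo_subset_Icc_self hr) (((offspringMean_eq_one_iff x).2 hx').trans hm.symm)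
  · rw [hpc]
    exact hr
  · rw [hpc]
    exact (offspringMean_eq_one_iff r).1 hm
end
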